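/- Let σ ∈ M^0_{ρ,Λ} be strongly M-elliptic of order 0: there exist C > 0 and R > 0 with Re σ(x,ξ) ≥ C for all x ∈ ℝⁿ and all |ξ| ≥ R. Then there exists a constant C' > 0 and, for every real number s ≥ ρ/2, a constant C_s > 0 such that for all φ ∈ 𝒮(ℝⁿ), Re ∫_{ℝⁿ} (T_σφ)(x) \overline{φ(x)} dx ≥ C' ∫_{ℝⁿ} |φ̂(ξ)|² dξ − C_s ∫_{ℝⁿ} Λ(ξ)^{−2s} |φ̂(ξ)|² dξ. -/

import Mathlib

open MeasureTheory Real Filter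
open scoped RealInnerProductSpace BigOperators ENNReal

noncomputable section

/-- Euclidean space ℝⁿ. -/
abbrev En (n : ℕ) : Type := EuclideanSpace ℝ (Fin n)

/-- Partial derivative in the `i`-th coordinate direction. -/
def pd {n : ℕ} {F : Type*} [NormedAddCommGroup F] [NormedSpace ℝ F]
    (i : Fin n) (f : En n → F) : En n → F :=
  fun x => fderiv ℝ f x (EuclideanSpace.single i 1)

/-- Iterated partial derivative `∂^α` for a multi-index `α`. -/
def mpd {n : ℕ} {F : Type*} [NormedAddCommGroup F] [NormedSpace ℝ F]
    (α : Fin n → ℕ) (f : En n → F) : En n → F :=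
  (List.finRange n).foldr (fun i g => (pd i)^[α i] g) f

/-- Mixed derivative `∂_x^α ∂_ξ^β σ` of a symbol. -/
def mixpd {n : ℕ} (α β : Fin n → ℕ) (σ : En n → En n → ℂ) : En n → En n → ℂ :=
  fun x ξ => mpd α (fun y => mpd β (σ y) ξ) x

/-- `Λ` is a weight function of polynomial growth with parameters `μ₀ ≤ μ₁ ≤ μ`. -/
structure IsWeight (n : ℕ) (Λ : En n → ℝ) (μ₀ μ₁ μ : ℝ) : Prop where
  pos : ∀ ξ, 0 < Λ ξ
  smooth : ContDiff ℝ (⊤ : ℕ∞) Λ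
  growth : ∃ C₀ C₁ : ℝ, 0 < C₀ ∧ C₀ ≤ C₁ ∧ ∀ ξ : En n,
    C₀ * (1 + ‖ξ‖) ^ μ₀ ≤ Λ ξ ∧ Λ ξ ≤ C₁ * (1 + ‖ξ‖) ^ μ₁
  hμ₀ : 0 < μ₀
  hμ₀₁ : μ₀ ≤ μ₁
  hμ₁ : μ₁ ≤ μ
  deriv_bound : ∀ (α γ : Fin n → ℕ), (∀ i, γ i ≤ 1) →
    ∃ C > 0, ∀ ξ : En n,
      |(∏ i, ξ i ^ γ i) * mpd (α + γ) Λ ξ| ≤ C * Λ ξ ^ (1 - (∑ i, (α i : ℝ)) / μ)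

/-- The symbol class `S^m_{ρ,Λ}`. -/
def SClass {n : ℕ} (Λ : En n → ℝ) (ρ m : ℝ) (σ : En n → En n → ℂ) : Prop :=
  ContDiff ℝ (⊤ : ℕ∞) (fun q : En n × En n => σ q.1 q.2) ∧
  ∀ α β : Fin n → ℕ, ∃ C > 0, ∀ x ξ : En n,
    ‖mixpd α β σ x ξ‖ ≤ C * Λ ξ ^ (m - ρ * ∑ i, (β i : ℝ))

/-- The symbol class `M^m_{ρ,Λ}`. -/
def MClass {n : ℕ} (Λ : En n → ℝ) (ρ m : ℝ) (σ : En n → En n → ℂ) : Prop :=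
  ∀ γ : Fin n → ℕ, (∀ i, γ i ≤ 1) →
    SClass Λ ρ m (fun x ξ => ((∏ i, ξ i ^ γ i : ℝ) : ℂ) * mixpd 0 γ σ x ξ)

/-- The Fourier transform `φ̂(ξ) = (2π)^{-n/2} ∫ e^{-ix·ξ} φ(x) dx`. -/
def ft {n : ℕ} (φ : En n → ℂ) (ξ : En n) : ℂ :=
  (((2 * Real.pi) ^ (-(n : ℝ) / 2) : ℝ) : ℂ) *
    ∫ (x : En n), Complex.exp (-Complex.I * (⟪x, ξ⟫ : ℂ)) * φ x

/-- The pseudo-differential operator `T_σ`. -/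
def pdo {n : ℕ} (σ : En n → En n → ℂ) (φ : En n → ℂ) (x : En n) : ℂ :=
  (((2 * Real.pi) ^ (-(n : ℝ) / 2) : ℝ) : ℂ) *
    ∫ (ξ : En n), Complex.exp (Complex.I * (⟪x, ξ⟫ : ℂ)) * σ x ξ * ft φ ξ

end

noncomputable section

/-- The SG symbol class `S^{m₁,m₂}_{ρ,Λ}`. -/
def SGClass {n : ℕ} (Λ : En n → ℝ) (ρ m₁ m₂ : ℝ) (σ : En n → En n → ℂ) : Prop :=
  ContDiff ℝ (⊤ : ℕ∞) (fun q : En n × En n => σ q.1 q.2) ∧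
  ∀ α β : Fin n → ℕ, ∃ C > 0, ∀ x ξ : En n,
    ‖mixpd α β σ x ξ‖ ≤
      C * Λ x ^ (m₂ - ρ * ∑ i, (α i : ℝ)) * Λ ξ ^ (m₁ - ρ * ∑ i, (β i : ℝ))

/-- The SG symbol class `M^{m₁,m₂}_{ρ,Λ}`. -/
def SGMClass {n : ℕ} (Λ : En n → ℝ) (ρ m₁ m₂ : ℝ) (σ : En n → En n → ℂ) : Prop :=
  ∀ γ δ : Fin n → ℕ, (∀ i, γ i ≤ 1) → (∀ i, δ i ≤ 1) →
    SGClass Λ ρ m₁ m₂ (fun x ξ =>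
      ((∏ i, x i ^ δ i : ℝ) : ℂ) * ((∏ i, ξ i ^ γ i : ℝ) : ℂ) * mixpd δ γ σ x ξ)

end
section Gaussian

variable {V : Type*} [NormedAddCommGroup V] [InnerProductSpace ℝ V]

lemma one_add_pow_mul_exp_neg_sq_le {b : ℝ} (hb : 0 < b) (m : ℕ) :
    ∃ C : ℝ, ∀ r : ℝ, 0 ≤ r → (1 + r) ^ m * Real.exp (-(b * r ^ 2)) ≤ C := by
  refine ⟨m.factorial * Real.exp (1 + 1 / (4 * b)), fun r hr => ?_⟩
  have h1 : (1 + r) ^ m ≤ m.factorial * Real.exp (1 + r) := by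
    have := Real.pow_div_factorial_le_exp (1 + r) (by positivity) m
    rw [div_le_iff₀ (by positivity)] at this
    linarith
  calc (1 + r) ^ m * Real.exp (-(b * r ^ 2))
      ≤ (m.factorial * Real.exp (1 + r)) * Real.exp (-(b * r ^ 2)) := by gcongr
    _ = m.factorial * Real.exp (1 + r - b * r ^ 2) := by
        rw [mul_assoc, ← Real.exp_add]; ring_nf
    _ ≤ _ := by
        gcongr
        have h2 : 0 ≤ b * (r - 1 / (2 * b)) ^ 2 := by positivity
        have h3 : b * (r - 1 / (2 * b)) ^ 2 = b * r ^ 2 - r + 1 / (4 * b) := by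
          field_simp; ring
        linarith

lemma norm_iteratedFDeriv_exp (i : ℕ) (x : ℝ) :
    ‖iteratedFDeriv ℝ i Real.exp x‖ = Real.exp x := by
  rw [norm_iteratedFDeriv_eq_norm_iteratedDeriv, iteratedDeriv_eq_iterate, Real.iter_deriv_exp]
  simp

/-- The real Gaussian `exp (-b ‖v‖²)` as a Schwartz function. -/
noncomputable def realGaussian (V : Type*) [NormedAddCommGroup V] [InnerProductSpace ℝ V]
    (b : ℝ) (hb : 0 < b) : SchwartzMap V ℝ where
  toFun v := Real.exp (-(b * ‖v‖ ^ 2))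
  smooth' := by
    have : ContDiff ℝ (⊤ : ℕ∞) (fun v : V => ‖v‖ ^ 2) := contDiff_norm_sq ℝ
    fun_prop
  decay' k n := by
    have hq : (fun v : V => -(b * ‖v‖ ^ 2)).HasTemperateGrowth :=
      (((Function.HasTemperateGrowth.const b).mul
        (by fun_prop : (fun v : V => ‖v‖ ^ 2).HasTemperateGrowth))).neg
    obtain ⟨l, C, hC, hl⟩ := hq.norm_iteratedFDeriv_le_uniform n
    obtain ⟨M, hM⟩ := one_add_pow_mul_exp_neg_sq_le hb (k + l * n)
    refine ⟨n.factorial * (1 + C) ^ n * M, fun x => ?_⟩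
    have key := norm_iteratedFDeriv_comp_le (n := n) (N := (⊤ : ℕ∞)) Real.contDiff_exp hq.1
      (by exact_mod_cast le_top) x
      (C := Real.exp (-(b * ‖x‖ ^ 2))) (D := (1 + C) * (1 + ‖x‖) ^ l)
      (fun i _ => (norm_iteratedFDeriv_exp i _).le)
      (fun i hi hin => by
        have h1 : (1 : ℝ) ≤ (1 + C) * (1 + ‖x‖) ^ l :=
          one_le_mul_of_one_le_of_one_le (by linarith)
            (one_le_pow₀ (by linarith [norm_nonneg x]))
        calc _ ≤ C * (1 + ‖x‖) ^ l := hl i hin x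
          _ ≤ (1 + C) * (1 + ‖x‖) ^ l := by gcongr; linarith
          _ ≤ _ := le_self_pow₀ h1 (by omega))
    calc ‖x‖ ^ k * ‖iteratedFDeriv ℝ n (Real.exp ∘ fun v : V => -(b * ‖v‖ ^ 2)) x‖
        ≤ (1 + ‖x‖) ^ k * (n.factorial * Real.exp (-(b * ‖x‖ ^ 2)) *
            ((1 + C) * (1 + ‖x‖) ^ l) ^ n) := by
          gcongr; linarith
      _ = n.factorial * (1 + C) ^ n * ((1 + ‖x‖) ^ (k + l * n) * Real.exp (-(b * ‖x‖ ^ 2))) := by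
          rw [mul_pow, ← pow_mul, pow_add]; ring
      _ ≤ _ := by gcongr; exact hM _ (norm_nonneg x)

/-- The Gaussian `exp (-b ‖v‖²)` as a complex valued Schwartz function. -/
noncomputable def gaussian (V : Type*) [NormedAddCommGroup V] [InnerProductSpace ℝ V]
    (b : ℝ) (hb : 0 < b) : SchwartzMap V ℂ :=
  (realGaussian V b hb).postcompCLM Complex.ofRealCLM

lemma gaussian_apply (b : ℝ) (hb : 0 < b) (v : V) :
    gaussian V b hb v = (Real.exp (-(b * ‖v‖ ^ 2)) : ℂ) := rfl

end Gaussian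

section KernelBound

variable {V : Type*} [NormedAddCommGroup V] [InnerProductSpace ℝ V] [FiniteDimensional ℝ V]
  [MeasurableSpace V] [BorelSpace V]

/-- Uniform decay of the Fourier transform of a symbol times a Schwartz function. -/
lemma fourier_mul_schwartz_decay (γ : SchwartzMap V ℂ) (N : ℕ) :
    ∃ A : ℝ, 0 < A ∧ ∀ (a : V → ℂ) (W : ℝ), ContDiff ℝ (⊤ : ℕ∞) a →
      (∀ k ≤ N, ∀ z, ‖iteratedFDeriv ℝ k a z‖ ≤ W * (1 + ‖z‖) ^ 2) →
      Integrable (fun z => a z * γ z) ∧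
      ∀ ζ, ‖FourierTransform.fourier (fun z => a z * γ z) ζ‖ * (1 + ‖ζ‖) ^ N ≤ A * W := by
  set Q : ℕ → V → ℝ := fun n z => ∑ i ∈ Finset.range (n + 1),
    (n.choose i : ℝ) * ((1 + ‖z‖) ^ 2 * ‖iteratedFDeriv ℝ (n - i) γ z‖) with hQ
  have hQi : ∀ n, Integrable (Q n) := by
    intro n
    refine integrable_finsetSum _ fun i _ => Integrable.const_mul ?_ _
    have h0 := γ.integrable_pow_mul_iteratedFDeriv volume 0 (n - i)
    have h1 := γ.integrable_pow_mul_iteratedFDeriv volume 1 (n - i)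
    have h2 := γ.integrable_pow_mul_iteratedFDeriv volume 2 (n - i)
    refine ((h0.add (h1.const_mul 2)).add h2).congr (Eventually.of_forall fun z => ?_)
    simp only [Pi.add_apply, pow_zero, one_mul, pow_one]
    ring
  have hQ0 : ∀ n z, 0 ≤ Q n z := fun n z => Finset.sum_nonneg fun i _ => by positivity
  set S : ℝ := ∑ n ∈ Finset.range (N + 1), ∫ z, Q n z with hS
  have hS0 : 0 ≤ S := Finset.sum_nonneg fun n _ => integral_nonneg (hQ0 n)
  refine ⟨2 ^ N * (2 ^ N * S + 2 ^ N * S) + 1, by positivity, fun a W ha hW => ?_⟩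
  have hW0 : 0 ≤ W := by
    have := (norm_nonneg _).trans (hW 0 (Nat.zero_le _) 0)
    simpa using this
  have hbd : ∀ n ≤ N, ∀ z, ‖iteratedFDeriv ℝ n (fun z => a z * γ z) z‖ ≤ W * Q n z := by
    intro n hn z
    refine (norm_iteratedFDeriv_mul_le (N := (⊤ : ℕ∞)) ha (γ.smooth _) z
      (by exact_mod_cast le_top)).trans ?_
    rw [hQ, Finset.mul_sum]
    refine Finset.sum_le_sum fun i hi => ?_
    rw [Finset.mem_range] at hi
    calc _ ≤ (n.choose i : ℝ) * (W * (1 + ‖z‖) ^ 2) * ‖iteratedFDeriv ℝ (n - i) γ z‖ := by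
          gcongr; exact hW i (by omega) z
      _ = _ := by ring
  have hsm : ContDiff ℝ (⊤ : ℕ∞) (fun z => a z * γ z) := ha.mul (γ.smooth _)
  have h_int : ∀ n ≤ N, Integrable (fun z => ‖iteratedFDeriv ℝ n (fun z => a z * γ z) z‖) := by
    intro n hn
    refine ((hQi n).const_mul W).mono' ?_ (Eventually.of_forall fun z => ?_)
    · exact (hsm.continuous_iteratedFDeriv (by exact_mod_cast le_top)).norm.aestronglyMeasurable
    · simpa using hbd n hn z
  have hI : Integrable (fun z => a z * γ z) := by
    have := h_int 0 (Nat.zero_le _)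
    simp only [norm_iteratedFDeriv_zero] at this
    exact (integrable_norm_iff hsm.continuous.aestronglyMeasurable).1 this
  refine ⟨hI, fun ζ => ?_⟩
  have key : ∀ n ≤ N, ‖ζ‖ ^ n * ‖FourierTransform.fourier (fun z => a z * γ z) ζ‖
      ≤ 2 ^ N * S * W := by
    intro n hn
    have := Real.pow_mul_norm_iteratedFDeriv_fourier_le (f := fun z => a z * γ z)
      (K := 0) (N := N) (hsm.of_le (by exact_mod_cast le_top)) (fun k m hk hm => by
        have hk0 : k = 0 := by simpa using hk
        subst hk0
        simpa using h_int m (by exact_mod_cast hm)) (k := 0) (n := n) (by simp)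
        (by exact_mod_cast hn) ζ
    simp only [norm_iteratedFDeriv_zero] at this
    refine this.trans ?_
    simp only [pow_zero, one_mul, Nat.cast_zero, mul_zero, zero_add, Finset.range_one]
    rw [Finset.sum_product]
    simp only [Finset.sum_singleton, pow_zero, one_mul]
    rw [mul_assoc]
    refine mul_le_mul (pow_le_pow_right₀ (by norm_num) hn) ?_ ?_ (by positivity)
    · calc _ ≤ ∑ m ∈ Finset.range (n + 1), W * ∫ z, Q m z := by
            refine Finset.sum_le_sum fun m hm => ?_
            have hm' : m ≤ N := by rw [Finset.mem_range] at hm; omega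
            rw [← integral_const_mul]
            exact integral_mono (h_int m hm') ((hQi m).const_mul W) (hbd m hm')
        _ ≤ ∑ m ∈ Finset.range (N + 1), W * ∫ z, Q m z := by
            refine Finset.sum_le_sum_of_subset_of_nonneg ?_ fun m _ _ => ?_
            · exact Finset.range_mono (by omega)
            · exact mul_nonneg hW0 (integral_nonneg (hQ0 m))
        _ = S * W := by rw [← Finset.mul_sum, mul_comm]
    · exact Finset.sum_nonneg fun m _ => integral_nonneg fun z => norm_nonneg _
  have hpow : (1 + ‖ζ‖) ^ N ≤ 2 ^ N * (1 + ‖ζ‖ ^ N) := by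
    have h2 : (1 + ‖ζ‖) ^ N ≤ 2 ^ (N - 1) * (1 ^ N + ‖ζ‖ ^ N) :=
      add_pow_le zero_le_one (norm_nonneg _) N
    rw [one_pow] at h2
    refine h2.trans ?_
    gcongr
    · norm_num
    · omega
  have k0 := key 0 (Nat.zero_le _)
  have kN := key N le_rfl
  rw [pow_zero, one_mul] at k0
  calc _ ≤ ‖FourierTransform.fourier (fun z => a z * γ z) ζ‖ * (2 ^ N * (1 + ‖ζ‖ ^ N)) := by
        gcongr
    _ = 2 ^ N * (‖FourierTransform.fourier (fun z => a z * γ z) ζ‖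
          + ‖ζ‖ ^ N * ‖FourierTransform.fourier (fun z => a z * γ z) ζ‖) := by ring
    _ ≤ 2 ^ N * (2 ^ N * S * W + 2 ^ N * S * W) := by gcongr
    _ ≤ _ := by nlinarith

end KernelBound

section Phase

/-- The unimodular phase `exp (2 π i θ)`. -/
noncomputable def phase (θ : ℝ) : ℂ := Complex.exp (((2 * π * θ : ℝ) : ℂ) * Complex.I)

lemma phase_add (a b : ℝ) : phase (a + b) = phase a * phase b := by
  rw [phase, phase, phase, ← Complex.exp_add]
  push_cast
  ring_nf

@[simp] lemma norm_phase (a : ℝ) : ‖phase a‖ = 1 := Complex.norm_exp_ofReal_mul_I _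

@[simp] lemma phase_zero : phase 0 = 1 := by simp [phase]

lemma conj_phase (a : ℝ) : (starRingEnd ℂ) (phase a) = phase (-a) := by
  rw [phase, phase, ← Complex.exp_conj, map_mul, Complex.conj_ofReal, Complex.conj_I]
  push_cast
  ring_nf

lemma continuous_phase : Continuous phase := by unfold phase; fun_prop

@[fun_prop]
lemma Continuous.phase {X : Type*} [TopologicalSpace X] {f : X → ℝ} (hf : Continuous f) :
    Continuous fun x => phase (f x) := continuous_phase.comp hf

variable {V : Type*} [NormedAddCommGroup V] [InnerProductSpace ℝ V] [FiniteDimensional ℝ V]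
  [MeasurableSpace V] [BorelSpace V]

lemma fourier_eq_phase (f : V → ℂ) (w : V) :
    FourierTransform.fourier f w = ∫ v, phase (-⟪v, w⟫) * f v := by
  rw [Real.fourier_eq']
  simp [phase]

lemma fourierInv_eq_phase (f : V → ℂ) (w : V) :
    FourierTransformInv.fourierInv f w = ∫ v, phase ⟪v, w⟫ * f v := by
  rw [Real.fourierInv_eq']
  simp [phase]

end Phase

section KernelDecomposition

lemma withLp_two_gaussian_apply {E : Type*} [NormedAddCommGroup E] [InnerProductSpace ℝ E]
    (b : ℝ) (hb : 0 < b) (v : WithLp 2 (E × E)) :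
    gaussian (WithLp 2 (E × E)) b hb v = gaussian E b hb v.fst * gaussian E b hb v.snd := by
  rw [gaussian_apply, gaussian_apply, gaussian_apply, WithLp.prod_norm_sq_eq_of_L2,
    ← Complex.ofReal_mul, ← Real.exp_add]
  congr 2
  ring

variable {E : Type*} [NormedAddCommGroup E] [InnerProductSpace ℝ E] [FiniteDimensional ℝ E]
  [MeasurableSpace E] [BorelSpace E]

lemma isAddHaarMeasure_volume_prod : (volume : Measure (E × E)).IsAddHaarMeasure :=
  inferInstanceAs ((volume : Measure E).prod volume).IsAddHaarMeasure

lemma integrable_prod_one_add_norm {N : ℕ} (hN : Module.finrank ℝ (E × E) < N) :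
    Integrable (fun ζ : E × E => ((1 + ‖ζ‖) ^ N)⁻¹) := by
  have := isAddHaarMeasure_volume_prod (E := E)
  have := integrable_one_add_norm (E := E × E) (μ := volume) (r := N) (by exact_mod_cast hN)
  refine this.congr (Eventually.of_forall fun ζ => ?_)
  simp only
  rw [Real.rpow_neg (by positivity), Real.rpow_natCast]

/-- A symbol times a Gaussian is a superposition of characters with a rapidly decaying density. -/
lemma exists_kernel_decomposition (b : ℝ) (hb : 0 < b) (N : ℕ)
    (hN : Module.finrank ℝ (E × E) < N) :
    ∃ A : ℝ, 0 < A ∧ ∀ (a : E × E → ℂ) (W : ℝ), ContDiff ℝ (⊤ : ℕ∞) a →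
      (∀ k ≤ N, ∀ z, ‖iteratedFDeriv ℝ k a z‖ ≤ W * (1 + ‖z‖) ^ 2) →
      ∃ κ : E × E → ℂ, Integrable κ ∧ (∀ ζ, ‖κ ζ‖ ≤ A * W * ((1 + ‖ζ‖) ^ N)⁻¹) ∧
        ∀ z : E × E, a z * (gaussian E b hb z.1 * gaussian E b hb z.2) =
          ∫ ζ : E × E, κ ζ * (phase ⟪ζ.1, z.1⟫ * phase ⟪ζ.2, z.2⟫) := by
  obtain ⟨A, hA, H⟩ := fourier_mul_schwartz_decay (gaussian (WithLp 2 (E × E)) b hb) N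
  refine ⟨A, hA, fun a W ha hW => ?_⟩
  have hW0 : 0 ≤ W := by
    have := (norm_nonneg _).trans (hW 0 (Nat.zero_le _) 0)
    simpa using this
  set T : WithLp 2 (E × E) ≃L[ℝ] E × E := WithLp.prodContinuousLinearEquiv 2 ℝ E E with hT
  have hTn : ∀ z : WithLp 2 (E × E), ‖T z‖ ≤ ‖z‖ := fun z => by
    have : T z = (z.fst, z.snd) := rfl
    rw [this, Prod.norm_mk]
    exact max_le (WithLp.norm_fst_le E z) (WithLp.norm_snd_le E z)
  have hT1 : ‖(T : WithLp 2 (E × E) →L[ℝ] E × E)‖ ≤ 1 :=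
    ContinuousLinearMap.opNorm_le_bound _ zero_le_one fun z => by simpa using hTn z
  have haT : ContDiff ℝ (⊤ : ℕ∞) (a ∘ T) := ha.comp T.contDiff
  obtain ⟨h_int, hdec⟩ := H (a ∘ T) W haT fun k hk z => by
    have h1 := (T : WithLp 2 (E × E) →L[ℝ] E × E).iteratedFDeriv_comp_right ha z
      (i := k) (by exact_mod_cast le_top)
    have h2 : iteratedFDeriv ℝ k (a ∘ T) z = _ := h1
    rw [h2]
    refine (ContinuousMultilinearMap.norm_compContinuousLinearMap_le _ _).trans ?_
    have h3 : (∏ _i : Fin k, ‖(T : WithLp 2 (E × E) →L[ℝ] E × E)‖) ≤ 1 :=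
      Finset.prod_le_one (fun _ _ => ContinuousLinearMap.opNorm_nonneg _) fun _ _ => hT1
    refine (mul_le_of_le_one_right (norm_nonneg _) h3).trans ((hW k hk _).trans ?_)
    gcongr
    exact hTn z
  set F : WithLp 2 (E × E) → ℂ := fun z => (a ∘ T) z * gaussian (WithLp 2 (E × E)) b hb z with hF
  have hFc : Continuous F := haT.continuous.mul (gaussian _ b hb).continuous
  have hFF : Continuous (FourierTransform.fourier F) :=
    VectorFourier.fourierIntegral_continuous Real.continuous_fourierChar
      (by exact continuous_inner) h_int
  have hbd : ∀ ζ : WithLp 2 (E × E),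
      ‖FourierTransform.fourier F ζ‖ ≤ A * W * ((1 + ‖T ζ‖) ^ N)⁻¹ := fun ζ => by
    rw [← div_eq_mul_inv, le_div_iff₀ (by positivity)]
    refine le_trans ?_ (hdec ζ)
    gcongr
    exact hTn ζ
  have hmp : MeasurePreserving (WithLp.toLp 2 : E × E → WithLp 2 (E × E)) :=
    WithLp.volume_preserving_toLp E E
  have hemb : MeasurableEmbedding (WithLp.toLp 2 : E × E → WithLp 2 (E × E)) :=
    (MeasurableEquiv.toLp 2 (E × E)).measurableEmbedding
  have hκ : Integrable (fun ζ : E × E => FourierTransform.fourier F (WithLp.toLp 2 ζ)) := by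
    refine ((integrable_prod_one_add_norm hN).const_mul (A * W)).mono' ?_
      (Eventually.of_forall fun ζ => hbd _)
    exact (hFF.comp T.symm.continuous).aestronglyMeasurable
  refine ⟨_, hκ, fun ζ => hbd _, fun z => ?_⟩
  have hFi : Integrable (FourierTransform.fourier F) :=
    (hmp.integrable_comp_emb hemb).1 hκ
  have hinv := congrFun (hFc.fourierInv_fourier_eq h_int hFi) (WithLp.toLp 2 z)
  rw [fourierInv_eq_phase, ← hmp.integral_comp hemb] at hinv
  have h2 : F (WithLp.toLp 2 z) = a z * (gaussian E b hb z.1 * gaussian E b hb z.2) := by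
    rw [hF]
    simp only [withLp_two_gaussian_apply]
    rfl
  rw [← h2, ← hinv]
  congr 1 with ζ
  rw [← phase_add, mul_comm]
  simp

end KernelDecomposition

section STFT

/-- The product of a translate of `f` with the window `h`. -/
noncomputable def windowed {E : Type*} [NormedAddCommGroup E] [InnerProductSpace ℝ E]
    (h f : SchwartzMap E ℂ) (η : E) : SchwartzMap E ℂ :=
  SchwartzMap.smulLeftCLM ℂ h (SchwartzMap.compSubConstCLM ℂ (-η) f)

lemma windowed_apply {E : Type*} [NormedAddCommGroup E] [InnerProductSpace ℝ E]
    (h f : SchwartzMap E ℂ) (η s : E) :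
    windowed h f η s = f (η + s) * h s := by
  rw [windowed, SchwartzMap.smulLeftCLM_apply_apply h.hasTemperateGrowth]
  simp [mul_comm, add_comm]

variable {E : Type*} [NormedAddCommGroup E] [InnerProductSpace ℝ E] [FiniteDimensional ℝ E]
  [MeasurableSpace E] [BorelSpace E]

/-- The short-time Fourier transform of `f` with window `h`. -/
noncomputable def stft (h f : E → ℂ) (q : E × E) : ℂ :=
  ∫ s, phase ⟪q.1, s⟫ * (f (q.2 + s) * h s)

lemma continuous_stft (h f : SchwartzMap E ℂ) : Continuous (stft h f) := by
  obtain ⟨C, hC⟩ := f.decay 0 0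
  refine continuous_of_dominated (bound := fun s => C * ‖h s‖) (fun q => ?_)
    (fun q => Eventually.of_forall fun s => ?_) (h.integrable.norm.const_mul C)
    (Eventually.of_forall fun s => ?_)
  · have := f.continuous
    have := h.continuous
    exact Continuous.aestronglyMeasurable (by fun_prop)
  · have := hC.2 (q.2 + s)
    simp only [pow_zero, norm_iteratedFDeriv_zero, one_mul] at this
    rw [norm_mul, norm_mul, norm_phase, one_mul]
    gcongr
  · have := f.continuous
    have := h.continuous
    fun_prop

lemma lintegral_enorm_sq_eq (f : SchwartzMap E ℂ) :
    ∫⁻ x, ‖f x‖ₑ ^ 2 = ENNReal.ofReal (∫ x, ‖f x‖ ^ 2) := by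
  rw [ofReal_integral_eq_lintegral_ofReal]
  · congr 1 with x
    rw [ENNReal.ofReal_pow (norm_nonneg _), ofReal_norm]
  · exact (f.memLp 2 volume).integrable_norm_pow (by norm_num)
  · exact Eventually.of_forall fun x => by positivity

lemma lintegral_stft_enorm_sq (h f : SchwartzMap E ℂ) (η : E) :
    ∫⁻ y, ‖stft h f (y, η)‖ₑ ^ 2 = ∫⁻ s, ‖f (η + s)‖ₑ ^ 2 * ‖h s‖ₑ ^ 2 := by
  have h1 : ∀ y, stft h f (y, η) = (FourierTransformInv.fourierInv (windowed h f η)) y := by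
    intro y
    rw [SchwartzMap.fourierInv_coe, fourierInv_eq_phase, stft]
    congr 1 with s
    rw [windowed_apply, real_inner_comm]
  have h2 := SchwartzMap.integral_norm_sq_fourier
    (FourierTransformInv.fourierInv (windowed h f η))
  rw [FourierTransform.fourier_fourierInv_eq] at h2
  simp_rw [h1, lintegral_enorm_sq_eq]
  rw [← h2, ← lintegral_enorm_sq_eq]
  congr 1 with s
  rw [windowed_apply, enorm_mul, mul_pow]

lemma lintegral_stft_enorm_sq_total (h f : SchwartzMap E ℂ) :
    ∫⁻ q, ‖stft h f q‖ₑ ^ 2 = (∫⁻ s, ‖h s‖ₑ ^ 2) * ∫⁻ η, ‖f η‖ₑ ^ 2 := by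
  have hm : Measurable fun q => ‖stft h f q‖ₑ ^ 2 :=
    ((continuous_stft h f).enorm.measurable).pow_const 2
  have hf := f.continuous
  have hh := h.continuous
  rw [Measure.volume_eq_prod, lintegral_prod_symm _ hm.aemeasurable]
  simp_rw [lintegral_stft_enorm_sq]
  rw [lintegral_lintegral_swap]
  · have hs : ∀ s, ∫⁻ η, ‖f (η + s)‖ₑ ^ 2 * ‖h s‖ₑ ^ 2 = (∫⁻ η, ‖f η‖ₑ ^ 2) * ‖h s‖ₑ ^ 2 := by
      intro s
      rw [lintegral_mul_const' _ _ (by finiteness),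
        lintegral_add_right_eq_self (fun x => ‖f x‖ₑ ^ 2)]
    simp_rw [hs]
    rw [lintegral_const_mul, mul_comm]
    exact hh.enorm.measurable.pow_const 2
  · simp only [Function.uncurry_def]
    refine Measurable.aemeasurable (Measurable.fun_mul ?_ ?_)
    · exact (Continuous.enorm (by fun_prop)).measurable.pow_const 2
    · exact (Continuous.enorm (by fun_prop)).measurable.pow_const 2

lemma lintegral_weight_stft_enorm_sq_le (h f : SchwartzMap E ℂ) {w : E → ℝ}
    (hwc : Continuous w) (hws : ∀ η η', w η ≤ (1 + ‖η - η'‖) * w η') :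
    ∫⁻ q, ENNReal.ofReal (w q.2) * ‖stft h f q‖ₑ ^ 2 ≤
      (∫⁻ s, ENNReal.ofReal (1 + ‖s‖) * ‖h s‖ₑ ^ 2) *
        ∫⁻ η, ENNReal.ofReal (w η) * ‖f η‖ₑ ^ 2 := by
  have hf := f.continuous
  have hh := h.continuous
  have hm : Measurable fun q : E × E => ENNReal.ofReal (w q.2) * ‖stft h f q‖ₑ ^ 2 :=
    (by fun_prop : Continuous fun q : E × E => w q.2).measurable.ennreal_ofReal.mul
      (((continuous_stft h f).enorm.measurable).pow_const 2)
  rw [Measure.volume_eq_prod, lintegral_prod_symm _ hm.aemeasurable]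
  simp_rw [lintegral_const_mul' _ _ ENNReal.ofReal_ne_top, lintegral_stft_enorm_sq,
    ← lintegral_const_mul' _ _ ENNReal.ofReal_ne_top]
  rw [lintegral_lintegral_swap]
  · rw [← lintegral_mul_const]
    · refine lintegral_mono fun s => ?_
      rw [← lintegral_add_right_eq_self (fun η => ENNReal.ofReal (w η) * ‖f η‖ₑ ^ 2) s,
        ← lintegral_const_mul' _ _ (by finiteness)]
      refine lintegral_mono fun η => ?_
      have h1 : ENNReal.ofReal (w η) ≤ ENNReal.ofReal (1 + ‖s‖) * ENNReal.ofReal (w (η + s)) := by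
        rw [← ENNReal.ofReal_mul (by positivity)]
        refine ENNReal.ofReal_le_ofReal ((hws η (η + s)).trans_eq ?_)
        simp
      calc _ ≤ (ENNReal.ofReal (1 + ‖s‖) * ENNReal.ofReal (w (η + s))) *
            (‖f (η + s)‖ₑ ^ 2 * ‖h s‖ₑ ^ 2) := by gcongr
        _ = _ := by ring
    · exact (Continuous.measurable (by fun_prop)).ennreal_ofReal.mul
        (hh.enorm.measurable.pow_const 2)
  · simp only [Function.uncurry_def]
    refine Measurable.aemeasurable (Measurable.fun_mul ?_ (Measurable.fun_mul ?_ ?_))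
    · exact (by fun_prop : Continuous fun q : E × E => w q.1).measurable.ennreal_ofReal
    · exact (Continuous.enorm (by fun_prop)).measurable.pow_const 2
    · exact (Continuous.enorm (by fun_prop)).measurable.pow_const 2

lemma lintegral_one_add_norm_window_lt_top (h : SchwartzMap E ℂ) :
    ∫⁻ s, ENNReal.ofReal (1 + ‖s‖) * ‖h s‖ₑ ^ 2 < ∞ := by
  obtain ⟨C, hC⟩ := h.decay 0 0
  have h0 := h.integrable_pow_mul volume 0
  have h1 := h.integrable_pow_mul volume 1
  have h2 : Integrable fun s => C * ((1 + ‖s‖) * ‖h s‖) := by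
    refine ((h0.add h1).const_mul C).congr (Eventually.of_forall fun s => ?_)
    simp only [Pi.add_apply, pow_zero, one_mul, pow_one]
    ring
  refine lt_of_le_of_lt (lintegral_mono fun s => ?_) h2.lintegral_lt_top
  rw [← ofReal_norm, ← ENNReal.ofReal_pow (norm_nonneg _),
    ← ENNReal.ofReal_mul (by positivity)]
  refine ENNReal.ofReal_le_ofReal ?_
  have := hC.2 s
  simp only [pow_zero, norm_iteratedFDeriv_zero, one_mul] at this
  calc (1 + ‖s‖) * ‖h s‖ ^ 2 = (1 + ‖s‖) * ‖h s‖ * ‖h s‖ := by ring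
    _ ≤ (1 + ‖s‖) * ‖h s‖ * C := by gcongr
    _ = _ := by ring

/-- The time side representation of the short-time Fourier transform of a Fourier transform. -/
lemma stft_fourier (h φ : SchwartzMap E ℂ) (q : E × E) :
    stft h (FourierTransform.fourier φ : SchwartzMap E ℂ) q = phase (-⟪q.1, q.2⟫) *
      ∫ t, phase (-⟪t, q.2⟫) * (φ (q.1 + t) * (FourierTransform.fourier h : SchwartzMap E ℂ) t) := by
  have hφ := φ.continuous
  have hh := h.continuous
  have h_int : Integrable (Function.uncurry fun s x : E =>
      phase ⟪q.1, s⟫ * phase (-⟪x, q.2 + s⟫) * (h s * φ x)) (volume.prod volume) := by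
    refine (h.integrable.mul_prod φ.integrable).mono
      (Continuous.aestronglyMeasurable (by fun_prop)) (Eventually.of_forall fun p => ?_)
    simp [Function.uncurry]
  calc stft h (FourierTransform.fourier φ : SchwartzMap E ℂ) q
      = ∫ s, ∫ x, phase ⟪q.1, s⟫ * phase (-⟪x, q.2 + s⟫) * (h s * φ x) := by
        rw [stft]
        congr 1 with s
        rw [SchwartzMap.fourier_coe, fourier_eq_phase, ← integral_mul_const, ← integral_const_mul]
        congr 1 with x
        ring
    _ = ∫ x, ∫ s, phase ⟪q.1, s⟫ * phase (-⟪x, q.2 + s⟫) * (h s * φ x) :=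
        integral_integral_swap h_int
    _ = ∫ t, ∫ s, phase ⟪q.1, s⟫ * phase (-⟪q.1 + t, q.2 + s⟫) * (h s * φ (q.1 + t)) :=
        (integral_add_left_eq_self (fun x => ∫ s, phase ⟪q.1, s⟫ *
          phase (-⟪x, q.2 + s⟫) * (h s * φ x)) q.1).symm
    _ = _ := by
        rw [← integral_const_mul]
        congr 1 with t
        rw [SchwartzMap.fourier_coe, fourier_eq_phase, ← integral_const_mul, ← integral_const_mul,
          ← integral_const_mul]
        congr 1 with s
        have : phase ⟪q.1, s⟫ * phase (-⟪q.1 + t, q.2 + s⟫) =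
            phase (-⟪q.1, q.2⟫) * (phase (-⟪t, q.2⟫) * phase (-⟪s, t⟫)) := by
          rw [← phase_add, ← phase_add, ← phase_add, inner_add_left, inner_add_right,
            inner_add_right, real_inner_comm s t]
          congr 1
          ring
        rw [this]
        ring

end STFT

section Husimi

variable {E : Type*} [NormedAddCommGroup E] [InnerProductSpace ℝ E]

lemma conj_gaussian (b : ℝ) (hb : 0 < b) (t : E) :
    (starRingEnd ℂ) (gaussian E b hb t) = gaussian E b hb t := by
  rw [gaussian_apply, Complex.conj_ofReal]

lemma gaussian_pi_eq_mul_self (t : E) :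
    gaussian E π pi_pos t = gaussian E (π / 2) (by positivity) t *
      gaussian E (π / 2) (by positivity) t := by
  rw [gaussian_apply, gaussian_apply, ← Complex.ofReal_mul, ← Real.exp_add]
  congr 2
  ring

lemma norm_iteratedFDeriv_translate_sub_le {σ : E × E → ℂ} {w : E → ℝ} {N : ℕ} (hN : 1 ≤ N)
    (hσ : ContDiff ℝ (⊤ : ℕ∞) σ) (hw0 : ∀ η, 0 ≤ w η)
    (hws : ∀ η η', w η ≤ (1 + ‖η - η'‖) * w η')
    (hd : ∀ k, 1 ≤ k → k ≤ N → ∀ z, ‖iteratedFDeriv ℝ k σ z‖ ≤ w z.2) (q : E × E) :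
    ∀ k ≤ N, ∀ z, ‖iteratedFDeriv ℝ k (fun z => σ (q + z) - σ q) z‖ ≤
      w q.2 * (1 + ‖z‖) ^ 2 := by
  intro k hk z
  have hsh : ∀ z : E × E, w (q + z).2 ≤ (1 + ‖z‖) * w q.2 := fun z => by
    refine (hws _ q.2).trans ?_
    gcongr
    · exact hw0 _
    · simpa using norm_snd_le z
  rcases Nat.eq_zero_or_pos k with rfl | hk1
  · rw [norm_iteratedFDeriv_zero]
    have hseg : ∀ x ∈ Metric.closedBall q ‖z‖, ‖fderiv ℝ σ x‖ ≤ (1 + ‖z‖) * w q.2 := by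
      intro x hx
      have h1 := hd 1 le_rfl hN x
      rw [norm_iteratedFDeriv_one] at h1
      have h2 := hsh (x - q)
      rw [add_sub_cancel] at h2
      refine h1.trans (h2.trans ?_)
      gcongr
      · exact hw0 _
      · simpa [dist_eq_norm] using hx
    have := (convex_closedBall q ‖z‖).norm_image_sub_le_of_norm_fderiv_le
      (fun x _ => (hσ.differentiable (by simp)).differentiableAt) hseg
      (Metric.mem_closedBall_self (norm_nonneg z)) (y := q + z) (by simp)
    rw [add_sub_cancel_left] at this
    refine this.trans ?_
    have := hw0 q.2
    have := norm_nonneg z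
    nlinarith [mul_nonneg (mul_nonneg (hw0 q.2) (norm_nonneg z)) (norm_nonneg z),
      mul_nonneg (hw0 q.2) (norm_nonneg z)]
  · have h1 : iteratedFDeriv ℝ k (fun z => σ (q + z) - σ q) z = iteratedFDeriv ℝ k σ (q + z) := by
      have h2 := iteratedFDeriv_sub_apply (𝕜 := ℝ) (i := k) (x := z) (f := fun z => σ (q + z))
        (g := fun _ => σ q)
        ((hσ.comp (contDiff_const.add contDiff_id)).contDiffAt.of_le (by exact_mod_cast le_top))
        contDiffAt_const
      have h3 : iteratedFDeriv ℝ k (fun z => σ (q + z) - σ q) z = _ := h2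
      rw [h3, iteratedFDeriv_const_of_ne (by omega), iteratedFDeriv_comp_add_left']
      simp
    rw [h1]
    refine (hd k hk1 hk _).trans ((hsh z).trans ?_)
    have := hw0 q.2
    have := norm_nonneg z
    nlinarith [mul_nonneg (mul_nonneg (hw0 q.2) (norm_nonneg z)) (norm_nonneg z),
      mul_nonneg (hw0 q.2) (norm_nonneg z)]

variable [FiniteDimensional ℝ E] [MeasurableSpace E] [BorelSpace E]

lemma schwartz_fourier_gaussian_pi :
    FourierTransform.fourier (gaussian E π pi_pos) = gaussian E π pi_pos := by
  ext w
  rw [SchwartzMap.fourier_coe]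
  have h := fourier_gaussian_innerProductSpace (V := E) (b := (π : ℂ))
    (by simpa using pi_pos) w
  have h1 : (⇑(gaussian E π pi_pos)) = fun v : E => Complex.exp (-(π : ℂ) * ‖v‖ ^ 2) := by
    ext v
    rw [gaussian_apply]
    push_cast
    ring_nf
  have hpi : (π : ℂ) ≠ 0 := by exact_mod_cast pi_ne_zero
  rw [h1, h, div_self hpi, Complex.one_cpow, one_mul]
  congr 1
  field_simp

/-- Integration against a conjugated windowed translate, as a short-time Fourier transform. -/
lemma integral_phase_conj_eq (h φ : SchwartzMap E ℂ) (k : E → ℂ)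
    (hk : ∀ t, (FourierTransform.fourier h : SchwartzMap E ℂ) t = k t)
    (hr : ∀ t, (starRingEnd ℂ) (k t) = k t) (q : E × E) :
    ∫ t, phase ⟪t, q.2⟫ * ((starRingEnd ℂ) (φ (q.1 + t)) * k t) =
      (starRingEnd ℂ) (phase ⟪q.1, q.2⟫ *
        stft h (FourierTransform.fourier φ : SchwartzMap E ℂ) q) := by
  rw [stft_fourier, ← mul_assoc, ← phase_add, add_neg_cancel, phase_zero, one_mul, ← integral_conj]
  congr 1 with t
  rw [map_mul, map_mul, conj_phase, neg_neg, hk, hr]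

/-- Integrating a superposition of characters against a tensor product. -/
lemma integral_superposition {κ : E × E → ℂ} (hκ : Integrable κ) {X Y : E → ℂ}
    (hX : Integrable X) (hY : Integrable Y) :
    ∫ z : E × E, (∫ ζ : E × E, κ ζ * (phase ⟪ζ.1, z.1⟫ * phase ⟪ζ.2, z.2⟫)) * (Y z.1 * X z.2) =
      ∫ ζ : E × E, κ ζ * ((∫ t, phase ⟪ζ.1, t⟫ * Y t) * ∫ s, phase ⟪ζ.2, s⟫ * X s) := by
  have hYX : Integrable (fun z : E × E => Y z.1 * X z.2) := hY.mul_prod hX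
  have h_int : Integrable (Function.uncurry fun z ζ : E × E =>
      κ ζ * (phase ⟪ζ.1, z.1⟫ * phase ⟪ζ.2, z.2⟫) * (Y z.1 * X z.2)) (volume.prod volume) := by
    have h1 := hYX.mul_prod hκ
    refine (h1.bdd_mul (c := 1)
      (f := fun p : (E × E) × (E × E) => phase ⟪p.2.1, p.1.1⟫ * phase ⟪p.2.2, p.1.2⟫) ?_ ?_).congr
      (Eventually.of_forall fun p => ?_)
    · exact Continuous.aestronglyMeasurable (by fun_prop)
    · exact Eventually.of_forall fun p => by simp
    · simp only [Function.uncurry_def]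
      ring
  have h2 : ∀ z : E × E,
      (∫ ζ : E × E, κ ζ * (phase ⟪ζ.1, z.1⟫ * phase ⟪ζ.2, z.2⟫)) * (Y z.1 * X z.2) =
        ∫ ζ : E × E, κ ζ * (phase ⟪ζ.1, z.1⟫ * phase ⟪ζ.2, z.2⟫) * (Y z.1 * X z.2) :=
    fun z => (integral_mul_const _ _).symm
  rw [integral_congr_ae (Eventually.of_forall h2), integral_integral_swap h_int]
  congr 1 with ζ
  rw [Measure.volume_eq_prod, ← integral_prod_mul, ← integral_const_mul]
  congr 1 with z
  ring

end Husimi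

section Smoothing

variable {E : Type*} [NormedAddCommGroup E] [InnerProductSpace ℝ E] [FiniteDimensional ℝ E]
  [MeasurableSpace E] [BorelSpace E]

lemma integrable_and_integral_translate_mul {H Φ : E × E → ℂ} (hH : Integrable H)
    (hΦ : Integrable Φ) :
    Integrable (fun q => ∫ z, H (q + z) * Φ z) ∧
      ∫ q, ∫ z, H (q + z) * Φ z = (∫ q, H q) * ∫ z, Φ z := by
  have := isAddHaarMeasure_volume_prod (E := E)
  have h_int : Integrable (Function.uncurry fun q z : E × E => H (q + z) * Φ z)
      (volume.prod volume) := by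
    have h1 := hH.mul_prod hΦ
    have h2 := (measurePreserving_add_prod (volume : Measure (E × E))
      (volume : Measure (E × E))).integrable_comp_of_integrable h1
    exact h2
  refine ⟨h_int.integral_prod_left, ?_⟩
  rw [integral_integral_swap h_int]
  simp_rw [integral_mul_const]
  have : ∀ z : E × E, ∫ q, H (q + z) = ∫ q, H q := fun z => integral_add_right_eq_self H z
  simp_rw [this]
  rw [integral_const_mul]

/-- The Kirkwood–Rihaczek distribution of a Schwartz function. -/
noncomputable def kirkwood (φ : SchwartzMap E ℂ) (z : E × E) : ℂ :=
  phase ⟪z.1, z.2⟫ *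
    ((starRingEnd ℂ) (φ z.1) * (FourierTransform.fourier φ : SchwartzMap E ℂ) z.2)

/-- The mollifier turning the Kirkwood–Rihaczek distribution into a positive one. -/
noncomputable def mollifier (z : E × E) : ℂ :=
  phase (-⟪z.1, z.2⟫) * (gaussian E π pi_pos z.1 * gaussian E π pi_pos z.2)

lemma integrable_phase_mul {X : Type*} [MeasurableSpace X] [TopologicalSpace X]
    [OpensMeasurableSpace X] {ν : Measure X} {f : X → ℂ} (hf : Integrable f ν) {θ : X → ℝ}
    (hθ : Continuous θ) : Integrable (fun x => phase (θ x) * f x) ν :=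
  hf.bdd_mul (c := 1) hθ.phase.aestronglyMeasurable (Eventually.of_forall fun x => by simp)

lemma integrable_conj_schwartz (φ : SchwartzMap E ℂ) :
    Integrable fun x => (starRingEnd ℂ) (φ x) :=
  (Complex.conjLIE.toContinuousLinearEquiv.integrable_comp_iff).2 φ.integrable

lemma integrable_kirkwood (φ : SchwartzMap E ℂ) : Integrable (kirkwood φ) :=
  integrable_phase_mul ((integrable_conj_schwartz φ).mul_prod
    (FourierTransform.fourier φ : SchwartzMap E ℂ).integrable)
    (by fun_prop : Continuous fun z : E × E => ⟪z.1, z.2⟫)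

lemma integrable_mollifier : Integrable (mollifier (E := E)) :=
  integrable_phase_mul ((gaussian E π pi_pos).integrable.mul_prod (gaussian E π pi_pos).integrable)
    (by fun_prop : Continuous fun z : E × E => -⟪z.1, z.2⟫)

lemma integral_mollifier :
    ∫ z : E × E, mollifier z = ((∫ s : E, ‖gaussian E π pi_pos s‖ ^ 2 : ℝ) : ℂ) := by
  have h := integrable_mollifier (E := E)
  rw [Measure.volume_eq_prod] at h ⊢
  rw [integral_prod_symm _ h, ← integral_complex_ofReal]
  congr 1 with s
  have h1 : ∀ t : E, mollifier (t, s) =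
      (phase (-⟪t, s⟫) * gaussian E π pi_pos t) * gaussian E π pi_pos s := fun t => by
    rw [mollifier]; ring
  simp_rw [h1]
  rw [integral_mul_const, ← fourier_eq_phase, ← SchwartzMap.fourier_coe,
    schwartz_fourier_gaussian_pi, gaussian_apply]
  rw [Complex.norm_real, Real.norm_eq_abs, sq_abs]
  push_cast
  ring

/-- A modulated translate of `f` times a window, whose integral is `stft h f q`. -/
noncomputable def freqAtom (h f : SchwartzMap E ℂ) (q : E × E) (s : E) : ℂ :=
  phase ⟪q.1, s⟫ * (f (q.2 + s) * h s)

/-- A modulated translate of `conj φ` times a window. -/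
noncomputable def timeAtom (h φ : SchwartzMap E ℂ) (q : E × E) (t : E) : ℂ :=
  phase ⟪t, q.2⟫ * ((starRingEnd ℂ) (φ (q.1 + t)) * h t)

lemma integrable_freqAtom (h f : SchwartzMap E ℂ) (q : E × E) : Integrable (freqAtom h f q) := by
  refine integrable_phase_mul ?_ (by fun_prop)
  exact (windowed h f q.2).integrable.congr (Eventually.of_forall fun s => windowed_apply _ _ _ _)

lemma integrable_timeAtom (h φ : SchwartzMap E ℂ) (hr : ∀ t, (starRingEnd ℂ) (h t) = h t)
    (q : E × E) : Integrable (timeAtom h φ q) := by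
  refine integrable_phase_mul ?_ (by fun_prop)
  refine (integrable_conj_schwartz (windowed h φ q.1)).congr (Eventually.of_forall fun s => ?_)
  simp only [windowed_apply, map_mul, hr]

lemma kirkwood_add_mul_mollifier (φ : SchwartzMap E ℂ) (q z : E × E) :
    kirkwood φ (q + z) * mollifier z = phase ⟪q.1, q.2⟫ *
      (timeAtom (gaussian E π pi_pos) φ q z.1 *
        freqAtom (gaussian E π pi_pos) (FourierTransform.fourier φ : SchwartzMap E ℂ) q z.2) := by
  have : phase ⟪(q + z).1, (q + z).2⟫ * phase (-⟪z.1, z.2⟫) =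
      phase ⟪q.1, q.2⟫ * (phase ⟪z.1, q.2⟫ * phase ⟪q.1, z.2⟫) := by
    rw [← phase_add, ← phase_add, ← phase_add, Prod.fst_add, Prod.snd_add, inner_add_left,
      inner_add_right, inner_add_right]
    congr 1
    ring
  rw [kirkwood, mollifier, timeAtom, freqAtom]
  linear_combination (((starRingEnd ℂ) (φ (q + z).1) *
    (FourierTransform.fourier φ : SchwartzMap E ℂ) (q + z).2) *
    (gaussian E π pi_pos z.1 * gaussian E π pi_pos z.2)) * this

lemma integrable_kirkwood_add_mul_mollifier (φ : SchwartzMap E ℂ) (q : E × E) :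
    Integrable fun z => kirkwood φ (q + z) * mollifier z := by
  simp_rw [kirkwood_add_mul_mollifier]
  exact ((integrable_timeAtom _ _ (conj_gaussian _ _) q).mul_prod
    (integrable_freqAtom _ _ q)).const_mul _

/-- The mollified Kirkwood–Rihaczek distribution is a spectrogram. -/
lemma integral_kirkwood_add_mul_mollifier (φ : SchwartzMap E ℂ) (q : E × E) :
    ∫ z, kirkwood φ (q + z) * mollifier z =
      ((‖stft (gaussian E π pi_pos) (FourierTransform.fourier φ : SchwartzMap E ℂ) q‖ ^ 2 : ℝ) :
        ℂ) := by
  simp_rw [kirkwood_add_mul_mollifier]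
  rw [integral_const_mul, Measure.volume_eq_prod, integral_prod_mul]
  have h1 : ∫ t, timeAtom (gaussian E π pi_pos) φ q t = _ :=
    integral_phase_conj_eq (gaussian E π pi_pos) φ (gaussian E π pi_pos)
      (fun t => by rw [schwartz_fourier_gaussian_pi]) (conj_gaussian _ _) q
  have h2 : ∫ s, freqAtom (gaussian E π pi_pos) (FourierTransform.fourier φ : SchwartzMap E ℂ) q s
    = stft (gaussian E π pi_pos) (FourierTransform.fourier φ : SchwartzMap E ℂ) q := rfl
  rw [h1, h2, map_mul, conj_phase, mul_assoc, ← mul_assoc (phase _) (phase _), ← phase_add,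
    add_neg_cancel, phase_zero, one_mul, Complex.conj_mul']
  push_cast
  rfl

/-- The smoothed symbol error as a superposition of products of short-time Fourier transforms. -/
lemma norm_integral_kernel_le (φ : SchwartzMap E ℂ) (q : E × E) {a κ : E × E → ℂ}
    (hκ : Integrable κ)
    (ha : ∀ z : E × E, a z * (gaussian E (π / 2) (by positivity) z.1 *
      gaussian E (π / 2) (by positivity) z.2) =
        ∫ ζ : E × E, κ ζ * (phase ⟪ζ.1, z.1⟫ * phase ⟪ζ.2, z.2⟫)) :
    ‖∫ z, a z * (kirkwood φ (q + z) * mollifier z)‖ₑ ≤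
      ∫⁻ ζ, ‖κ ζ‖ₑ *
        (‖stft (FourierTransformInv.fourierInv (gaussian E (π / 2) (by positivity)) :
            SchwartzMap E ℂ) (FourierTransform.fourier φ : SchwartzMap E ℂ)
            (q.1, q.2 + ζ.1)‖ₑ *
          ‖stft (gaussian E (π / 2) (by positivity))
            (FourierTransform.fourier φ : SchwartzMap E ℂ) (q.1 + ζ.2, q.2)‖ₑ) := by
  set γ := gaussian E (π / 2) (by positivity) with hγ
  set f := (FourierTransform.fourier φ : SchwartzMap E ℂ) with hf
  have h1 : ∀ z : E × E, a z * (kirkwood φ (q + z) * mollifier z) = phase ⟪q.1, q.2⟫ *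
      ((∫ ζ : E × E, κ ζ * (phase ⟪ζ.1, z.1⟫ * phase ⟪ζ.2, z.2⟫)) *
        (timeAtom γ φ q z.1 * freqAtom γ f q z.2)) := by
    intro z
    rw [kirkwood_add_mul_mollifier, ← ha, timeAtom, timeAtom, freqAtom, freqAtom,
      gaussian_pi_eq_mul_self, gaussian_pi_eq_mul_self]
    ring
  simp_rw [h1]
  rw [integral_const_mul, integral_superposition hκ (integrable_freqAtom _ _ q)
    (integrable_timeAtom γ φ (conj_gaussian _ _) q), enorm_mul]
  have h0 : ∀ θ, ‖phase θ‖ₑ = 1 := fun θ => by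
    rw [← ofReal_norm, norm_phase, ENNReal.ofReal_one]
  rw [h0, one_mul]
  refine (enorm_integral_le_lintegral_enorm _).trans (lintegral_mono fun ζ => ?_)
  rw [enorm_mul, enorm_mul]
  have h2 : ∫ s, phase ⟪ζ.2, s⟫ * freqAtom γ f q s = stft γ f (q.1 + ζ.2, q.2) := by
    rw [stft]
    congr 1 with s
    rw [freqAtom, ← mul_assoc, ← phase_add, inner_add_left, add_comm]
  have h3 : ∫ t, phase ⟪ζ.1, t⟫ * timeAtom γ φ q t = (starRingEnd ℂ) (phase ⟪q.1, q.2 + ζ.1⟫ *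
      stft (FourierTransformInv.fourierInv γ : SchwartzMap E ℂ) f (q.1, q.2 + ζ.1)) := by
    refine Eq.trans ?_ (integral_phase_conj_eq (FourierTransformInv.fourierInv γ) φ γ
      (fun t => by rw [FourierTransform.fourier_fourierInv_eq]) (conj_gaussian _ _)
      (q.1, q.2 + ζ.1))
    congr 1 with t
    rw [timeAtom, ← mul_assoc, ← phase_add, inner_add_right, add_comm, real_inner_comm ζ.1]
  rw [h2, h3, map_mul, enorm_mul, conj_phase, h0, one_mul]
  gcongr
  rw [← ofReal_norm, RCLike.norm_conj, ofReal_norm]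

end Smoothing

section Core

variable {E : Type*} [NormedAddCommGroup E] [InnerProductSpace ℝ E] [FiniteDimensional ℝ E]
  [MeasurableSpace E] [BorelSpace E]

lemma lintegral_weight_translate_freq_le {w : E → ℝ} (hw0 : ∀ η, 0 ≤ w η)
    (hws : ∀ η η', w η ≤ (1 + ‖η - η'‖) * w η')
    (F : E × E → ℝ≥0∞) (ζ : E × E) :
    ∫⁻ q : E × E, ENNReal.ofReal (w q.2) * F (q.1, q.2 + ζ.1) ≤
      ENNReal.ofReal (1 + ‖ζ‖) * ∫⁻ q : E × E, ENNReal.ofReal (w q.2) * F q := by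
  have := isAddHaarMeasure_volume_prod (E := E)
  rw [← lintegral_add_right_eq_self (fun q : E × E => ENNReal.ofReal (w q.2) * F q) (0, ζ.1),
    ← lintegral_const_mul' _ _ ENNReal.ofReal_ne_top]
  refine lintegral_mono fun q => ?_
  rw [← mul_assoc, ← ENNReal.ofReal_mul (by positivity)]
  have h1 : q + (0, ζ.1) = (q.1, q.2 + ζ.1) := by ext <;> simp
  rw [h1]
  gcongr
  refine (hws q.2 (q.2 + ζ.1)).trans ?_
  gcongr
  · exact hw0 _
  · simpa using norm_fst_le ζ

lemma lintegral_kernel_stft_le {w : E → ℝ} (hwc : Continuous w) (hw0 : ∀ η, 0 ≤ w η)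
    (hws : ∀ η η', w η ≤ (1 + ‖η - η'‖) * w η') (h₁ h₂ f : SchwartzMap E ℂ) (k : E × E → ℝ)
    (hk : Continuous k) :
    ∫⁻ q : E × E, ∫⁻ ζ : E × E, ENNReal.ofReal (w q.2 * k ζ) *
        (‖stft h₁ f (q.1, q.2 + ζ.1)‖ₑ * ‖stft h₂ f (q.1 + ζ.2, q.2)‖ₑ) ≤
      (∫⁻ ζ : E × E, ENNReal.ofReal ((1 + ‖ζ‖) * k ζ)) *
        ((∫⁻ s, ENNReal.ofReal (1 + ‖s‖) * ‖h₁ s‖ₑ ^ 2) +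
          ∫⁻ s, ENNReal.ofReal (1 + ‖s‖) * ‖h₂ s‖ₑ ^ 2) *
        ∫⁻ η, ENNReal.ofReal (w η) * ‖f η‖ₑ ^ 2 := by
  have := isAddHaarMeasure_volume_prod (E := E)
  have hc₁ := continuous_stft h₁ f
  have hc₂ := continuous_stft h₂ f
  have hm : Measurable (Function.uncurry fun q ζ : E × E => ENNReal.ofReal (w q.2 * k ζ) *
      (‖stft h₁ f (q.1, q.2 + ζ.1)‖ₑ * ‖stft h₂ f (q.1 + ζ.2, q.2)‖ₑ)) := by
    simp only [Function.uncurry_def]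
    refine Measurable.fun_mul (Measurable.ennreal_ofReal (Continuous.measurable (by fun_prop)))
      (Measurable.fun_mul ?_ ?_)
    · exact (Continuous.enorm (by fun_prop)).measurable
    · exact (Continuous.enorm (by fun_prop)).measurable
  rw [lintegral_lintegral_swap hm.aemeasurable, mul_assoc, ← lintegral_mul_const _ (by fun_prop)]
  refine lintegral_mono fun ζ => ?_
  have hab : ∀ a b : ℝ≥0∞, a * b ≤ a ^ 2 + b ^ 2 := fun a b => by
    rcases le_total a b with h | h
    · calc a * b ≤ b * b := by gcongr
        _ = b ^ 2 := (sq b).symm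
        _ ≤ _ := le_add_self
    · calc a * b ≤ a * a := by gcongr
        _ = a ^ 2 := (sq a).symm
        _ ≤ _ := le_self_add
  have h1 := (lintegral_weight_translate_freq_le hw0 hws (fun q => ‖stft h₁ f q‖ₑ ^ 2) ζ).trans
    (mul_le_mul_right (lintegral_weight_stft_enorm_sq_le h₁ f hwc hws) _)
  have h2 : ∫⁻ q : E × E, ENNReal.ofReal (w q.2) * ‖stft h₂ f (q.1 + ζ.2, q.2)‖ₑ ^ 2 ≤
      (∫⁻ s, ENNReal.ofReal (1 + ‖s‖) * ‖h₂ s‖ₑ ^ 2) *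
        ∫⁻ η, ENNReal.ofReal (w η) * ‖f η‖ₑ ^ 2 := by
    refine Eq.trans_le ?_ (lintegral_weight_stft_enorm_sq_le h₂ f hwc hws)
    rw [← lintegral_add_right_eq_self
      (fun q : E × E => ENNReal.ofReal (w q.2) * ‖stft h₂ f q‖ₑ ^ 2) (ζ.2, 0)]
    congr 1 with q
    have : q + (ζ.2, 0) = (q.1 + ζ.2, q.2) := by ext <;> simp
    rw [this]
  calc ∫⁻ q : E × E, ENNReal.ofReal (w q.2 * k ζ) *
        (‖stft h₁ f (q.1, q.2 + ζ.1)‖ₑ * ‖stft h₂ f (q.1 + ζ.2, q.2)‖ₑ)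
      ≤ ∫⁻ q : E × E, ENNReal.ofReal (k ζ) *
        (ENNReal.ofReal (w q.2) * ‖stft h₁ f (q.1, q.2 + ζ.1)‖ₑ ^ 2 +
          ENNReal.ofReal (w q.2) * ‖stft h₂ f (q.1 + ζ.2, q.2)‖ₑ ^ 2) := by
        refine lintegral_mono fun q => ?_
        rw [ENNReal.ofReal_mul (hw0 _)]
        refine (mul_le_mul_right (hab _ _) _).trans_eq ?_
        ring
    _ = ENNReal.ofReal (k ζ) *
        ((∫⁻ q : E × E, ENNReal.ofReal (w q.2) * ‖stft h₁ f (q.1, q.2 + ζ.1)‖ₑ ^ 2) +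
          ∫⁻ q : E × E, ENNReal.ofReal (w q.2) * ‖stft h₂ f (q.1 + ζ.2, q.2)‖ₑ ^ 2) := by
        rw [lintegral_const_mul' _ _ ENNReal.ofReal_ne_top, lintegral_add_left]
        refine Measurable.fun_mul (Measurable.ennreal_ofReal (Continuous.measurable (by fun_prop)))
          (Measurable.pow_const ?_ 2)
        exact (Continuous.enorm (by fun_prop)).measurable
    _ ≤ ENNReal.ofReal (k ζ) * (ENNReal.ofReal (1 + ‖ζ‖) *
        ((∫⁻ s, ENNReal.ofReal (1 + ‖s‖) * ‖h₁ s‖ₑ ^ 2) *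
          ∫⁻ η, ENNReal.ofReal (w η) * ‖f η‖ₑ ^ 2) + ENNReal.ofReal (1 + ‖ζ‖) *
        ((∫⁻ s, ENNReal.ofReal (1 + ‖s‖) * ‖h₂ s‖ₑ ^ 2) *
          ∫⁻ η, ENNReal.ofReal (w η) * ‖f η‖ₑ ^ 2)) := by
        gcongr
        refine h2.trans (le_mul_of_one_le_left (zero_le) ?_)
        rw [ENNReal.one_le_ofReal]
        linarith [norm_nonneg ζ]
    _ = _ := by
        rw [ENNReal.ofReal_mul (by positivity)]
        ring

/-- Gårding's inequality for symbols whose derivatives are controlled by a slowly varying weight. -/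
theorem garding_of_slowly_varying_weight (N : ℕ) (hN : Module.finrank ℝ (E × E) + 1 < N) :
    ∃ A : ℝ, 0 < A ∧ ∀ (σ : E × E → ℂ) (w : E → ℝ) (M D c : ℝ),
      ContDiff ℝ (⊤ : ℕ∞) σ → (∀ z, ‖σ z‖ ≤ M) → Continuous w → (∀ η, 0 ≤ w η) →
      (∀ η, w η ≤ D) → (∀ η η', w η ≤ (1 + ‖η - η'‖) * w η') →
      (∀ k, 1 ≤ k → k ≤ N → ∀ z, ‖iteratedFDeriv ℝ k σ z‖ ≤ w z.2) →
      (∀ z, c - w z.2 ≤ (σ z).re) → ∀ φ : SchwartzMap E ℂ,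
      c * (∫ η, ‖(FourierTransform.fourier φ : SchwartzMap E ℂ) η‖ ^ 2) -
        A * (∫ η, w η * ‖(FourierTransform.fourier φ : SchwartzMap E ℂ) η‖ ^ 2) ≤
      (∫ z, σ z * kirkwood φ z).re := by
  obtain ⟨A, hA, hker⟩ := exists_kernel_decomposition (E := E) (π / 2) (by positivity) N (by omega)
  set γ := gaussian E (π / 2) (by positivity) with hγ
  set γ' := (FourierTransformInv.fourierInv γ : SchwartzMap E ℂ) with hγ'
  set g := gaussian E π pi_pos with hg
  set k : E × E → ℝ := fun ζ => A * ((1 + ‖ζ‖) ^ N)⁻¹ with hk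
  have hkc : Continuous k := by
    have : ∀ ζ : E × E, (1 + ‖ζ‖) ^ N ≠ 0 := fun ζ => by positivity
    fun_prop (disch := assumption)
  -- the total mass of the Gaussian
  set m : ℝ := ∫ s : E, ‖g s‖ ^ 2 with hm
  have hm0 : 0 < m := by
    have h1 : Integrable fun s : E => ‖g s‖ ^ 2 :=
      (g.memLp 2 volume).integrable_norm_pow (by norm_num)
    rw [hm, integral_pos_iff_support_of_nonneg (fun s => by positivity) h1]
    have : Function.support (fun s : E => ‖g s‖ ^ 2) = Set.univ := by
      ext s
      simp [hg, gaussian_apply]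
    rw [this]
    exact Measure.measure_univ_pos.2 (NeZero.ne _)
  -- the error constant
  set L : ℝ≥0∞ := (∫⁻ ζ : E × E, ENNReal.ofReal ((1 + ‖ζ‖) * k ζ)) *
        ((∫⁻ s, ENNReal.ofReal (1 + ‖s‖) * ‖γ' s‖ₑ ^ 2) +
          ∫⁻ s, ENNReal.ofReal (1 + ‖s‖) * ‖γ s‖ₑ ^ 2) with hL
  have hLt : L < ∞ := by
    refine ENNReal.mul_lt_top ?_ (ENNReal.add_lt_top.2
      ⟨lintegral_one_add_norm_window_lt_top _, lintegral_one_add_norm_window_lt_top _⟩)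
    have h1 := (integrable_prod_one_add_norm (E := E) (N := N - 1) (by omega)).const_mul A
    refine lt_of_le_of_lt (lintegral_mono fun ζ => ?_) h1.lintegral_lt_top
    refine ENNReal.ofReal_le_ofReal (le_of_eq ?_)
    have h2 : (1 + ‖ζ‖) ^ N = (1 + ‖ζ‖) ^ (N - 1) * (1 + ‖ζ‖) := by
      rw [← pow_succ]; congr 1; omega
    have h3 : 0 < 1 + ‖ζ‖ := by positivity
    simp only [hk, h2]
    field_simp
  set G : ℝ≥0∞ := ∫⁻ s, ENNReal.ofReal (1 + ‖s‖) * ‖g s‖ₑ ^ 2 with hG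
  have hGt : G < ∞ := lintegral_one_add_norm_window_lt_top _
  refine ⟨(G.toReal + L.toReal) / m + 1, by positivity, ?_⟩
  intro σ w M D c hσ hM hwc hw0 hwD hws hd hell φ
  set f := (FourierTransform.fourier φ : SchwartzMap E ℂ) with hf
  have hfi : Integrable fun η => ‖f η‖ ^ 2 :=
    (f.memLp 2 volume).integrable_norm_pow (by norm_num)
  have hwfi : Integrable fun η => w η * ‖f η‖ ^ 2 :=
    hfi.bdd_mul (c := D) hwc.aestronglyMeasurable (Eventually.of_forall fun η => by
      rw [Real.norm_eq_abs, abs_of_nonneg (hw0 η)]; exact hwD η)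
  set I₀ := ∫ η, ‖f η‖ ^ 2 with hI₀
  set I₁ := ∫ η, w η * ‖f η‖ ^ 2 with hI₁
  have hI₁0 : 0 ≤ I₁ := integral_nonneg fun η => mul_nonneg (hw0 η) (by positivity)
  have hNf : ∫⁻ η, ENNReal.ofReal (w η) * ‖f η‖ₑ ^ 2 = ENNReal.ofReal I₁ := by
    rw [hI₁, ofReal_integral_eq_lintegral_ofReal hwfi
      (Eventually.of_forall fun η => mul_nonneg (hw0 η) (by positivity))]
    congr 1 with η
    rw [ENNReal.ofReal_mul (hw0 η), ENNReal.ofReal_pow (norm_nonneg _), ofReal_norm]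
  have hσk : Integrable fun z => σ z * kirkwood φ z :=
    (integrable_kirkwood φ).bdd_mul hσ.continuous.aestronglyMeasurable
      (Eventually.of_forall hM)
  -- the smoothed form
  set J : E × E → ℂ := fun q => ∫ z, σ (q + z) * kirkwood φ (q + z) * mollifier z with hJ
  obtain ⟨hJi, hJe⟩ := integrable_and_integral_translate_mul hσk integrable_mollifier
  rw [integral_mollifier] at hJe
  -- the spectrogram
  set P : E × E → ℝ := fun q => ‖stft g f q‖ ^ 2 with hP
  have hPc : Continuous P := (continuous_stft g f).norm.pow 2
  have hPe : ∀ q, ENNReal.ofReal (P q) = ‖stft g f q‖ₑ ^ 2 := fun q => by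
    rw [hP, ENNReal.ofReal_pow (norm_nonneg _), ofReal_norm]
  have hP0 : ∀ q, 0 ≤ P q := fun q => by positivity
  have hPl : ∫⁻ q, ENNReal.ofReal (P q) = ENNReal.ofReal (m * I₀) := by
    simp_rw [hPe]
    rw [lintegral_stft_enorm_sq_total, lintegral_enorm_sq_eq, lintegral_enorm_sq_eq,
      ENNReal.ofReal_mul hm0.le]
  have hPi : Integrable P := by
    refine ⟨hPc.aestronglyMeasurable, ?_⟩
    rw [hasFiniteIntegral_iff_ofReal (Eventually.of_forall hP0), hPl]
    exact ENNReal.ofReal_lt_top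
  have hPint : ∫ q, P q = m * I₀ := by
    rw [integral_eq_lintegral_of_nonneg_ae (Eventually.of_forall hP0) hPc.aestronglyMeasurable,
      hPl, ENNReal.toReal_ofReal]
    exact mul_nonneg hm0.le (integral_nonneg fun η => by positivity)
  have hwPi : Integrable fun q : E × E => w q.2 * P q :=
    hPi.bdd_mul (c := D) (hwc.comp continuous_snd).aestronglyMeasurable
      (Eventually.of_forall fun q => by
        rw [Real.norm_eq_abs, abs_of_nonneg (hw0 _)]; exact hwD _)
  have hwPint : ∫ q : E × E, w q.2 * P q ≤ G.toReal * I₁ := by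
    rw [integral_eq_lintegral_of_nonneg_ae
      (Eventually.of_forall fun q => mul_nonneg (hw0 _) (hP0 q)) hwPi.aestronglyMeasurable]
    refine ENNReal.toReal_le_of_le_ofReal (by positivity) ?_
    rw [ENNReal.ofReal_mul (by positivity), ENNReal.ofReal_toReal hGt.ne, ← hNf]
    refine le_trans (le_of_eq ?_) (lintegral_weight_stft_enorm_sq_le g f hwc hws)
    congr 1 with q
    rw [ENNReal.ofReal_mul (hw0 _), hPe]
  -- the smoothing error
  set R : E × E → ℂ := fun q => J q - σ q * (P q : ℂ) with hR
  have hσPi : Integrable fun q => σ q * (P q : ℂ) :=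
    hPi.ofReal.bdd_mul hσ.continuous.aestronglyMeasurable (Eventually.of_forall hM)
  have hRi : Integrable R := hJi.sub hσPi
  have hRe : ∀ q, R q = ∫ z, (σ (q + z) - σ q) * (kirkwood φ (q + z) * mollifier z) := by
    intro q
    have h1 := integrable_kirkwood_add_mul_mollifier φ q
    have h2 : Integrable fun z => σ (q + z) * (kirkwood φ (q + z) * mollifier z) :=
      h1.bdd_mul (hσ.continuous.comp (continuous_const.add continuous_id)).aestronglyMeasurable
        (Eventually.of_forall fun z => hM _)
    simp_rw [sub_mul]
    rw [integral_sub h2 (h1.const_mul _), integral_const_mul, integral_kirkwood_add_mul_mollifier]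
    simp only [hR, hJ, hP, mul_assoc]
    rfl
  have hRb : ∀ q, ‖R q‖ₑ ≤ ∫⁻ ζ : E × E, ENNReal.ofReal (w q.2 * k ζ) *
      (‖stft γ' f (q.1, q.2 + ζ.1)‖ₑ * ‖stft γ f (q.1 + ζ.2, q.2)‖ₑ) := by
    intro q
    obtain ⟨κ, hκi, hκb, hκ⟩ := hker (fun z => σ (q + z) - σ q) (w q.2)
      ((hσ.comp (contDiff_const.add contDiff_id)).sub contDiff_const)
      (norm_iteratedFDeriv_translate_sub_le (by omega) hσ hw0 hws hd q)
    rw [hRe]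
    refine (norm_integral_kernel_le φ q hκi hκ).trans (lintegral_mono fun ζ => ?_)
    gcongr
    rw [← ofReal_norm]
    refine ENNReal.ofReal_le_ofReal ((hκb ζ).trans_eq ?_)
    rw [hk]
    ring
  have hRint : ∫ q, ‖R q‖ ≤ L.toReal * I₁ := by
    rw [integral_norm_eq_lintegral_enorm hRi.aestronglyMeasurable]
    refine ENNReal.toReal_le_of_le_ofReal (by positivity) ?_
    rw [ENNReal.ofReal_mul (by positivity), ENNReal.ofReal_toReal hLt.ne, ← hNf]
    exact (lintegral_mono hRb).trans (lintegral_kernel_stft_le hwc hw0 hws γ' γ f k hkc)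
  -- conclusion
  have hlow : ∀ q, c * P q - w q.2 * P q - ‖R q‖ ≤ (J q).re := by
    intro q
    have h1 : J q = σ q * (P q : ℂ) + R q := by rw [hR]; ring
    have h2 : (J q).re = (σ q).re * P q + (R q).re := by
      rw [h1, Complex.add_re, Complex.re_mul_ofReal]
    have h3 := (abs_le.1 (Complex.abs_re_le_norm (R q))).1
    have h4 := mul_le_mul_of_nonneg_right (hell q) (hP0 q)
    rw [h2]
    linarith
  have hfin : c * (m * I₀) - G.toReal * I₁ - L.toReal * I₁ ≤ m * (∫ z, σ z * kirkwood φ z).re := by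
    have h1 : ∫ q, (c * P q - w q.2 * P q - ‖R q‖) ≤ ∫ q, (J q).re :=
      integral_mono (((hPi.const_mul c).sub hwPi).sub hRi.norm) hJi.re hlow
    have h2 : ∫ q, (J q).re = (∫ q, J q).re := integral_re hJi
    have h3 : Integrable fun q : E × E => c * P q - w q.2 * P q := (hPi.const_mul c).sub hwPi
    have h4 : ∫ q, J q = (∫ q, σ q * kirkwood φ q) * (m : ℂ) := hJe
    rw [integral_sub h3 hRi.norm, integral_sub (hPi.const_mul c) hwPi,
      integral_const_mul, hPint, h2, h4, Complex.re_mul_ofReal] at h1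
    linarith
  have hdiv : c * I₀ - (G.toReal + L.toReal) / m * I₁ ≤ (∫ z, σ z * kirkwood φ z).re := by
    have h1 : m * (c * I₀ - (G.toReal + L.toReal) / m * I₁) =
        c * (m * I₀) - G.toReal * I₁ - L.toReal * I₁ := by
      field_simp
      ring
    rw [← h1] at hfin
    exact le_of_mul_le_mul_left hfin hm0
  linarith

end Core

section SmoothFunctions

variable (W : Type*) [NormedAddCommGroup W] [NormedSpace ℝ W]

/-- Smooth complex-valued functions on a normed space. -/
def Smooth : Type _ := {F : W → ℂ // ContDiff ℝ (⊤ : ℕ∞) F}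

variable {W}

/-- The derivative of a smooth function in the direction `v`. -/
noncomputable def dirDeriv (v : W) (F : Smooth W) : Smooth W :=
  ⟨fun z => fderiv ℝ F.1 z v,
    (F.2.fderiv_right (m := ((⊤ : ℕ∞) : WithTop ℕ∞)) (by norm_cast)).clm_apply contDiff_const⟩

lemma dirDeriv_comm (u v : W) : Function.Commute (dirDeriv u) (dirDeriv v) := by
  intro F
  have key : ∀ (a b : W) z, (dirDeriv a (dirDeriv b F)).1 z
      = fderiv ℝ (fderiv ℝ F.1) z a b := by
    intro a b z
    have hd : DifferentiableAt ℝ (fderiv ℝ F.1) z :=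
      ((F.2.fderiv_right (m := ((⊤ : ℕ∞) : WithTop ℕ∞)) (by norm_cast)).differentiable
        (by simp)) z
    change fderiv ℝ (fun y => fderiv ℝ F.1 y b) z a = _
    rw [fderiv_clm_apply hd (differentiableAt_const b)]
    simp
  refine Subtype.ext (funext fun z => ?_)
  rw [key, key]
  have h2 : (2 : WithTop ℕ∞) ≤ ((⊤ : ℕ∞) : WithTop ℕ∞) := WithTop.coe_le_coe.mpr le_top
  exact (F.2.contDiffAt.isSymmSndFDerivAt (by simpa using h2)) u v

/-- The iterated derivative of a smooth function along a family of directions, indexed by a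
multi-index. -/
noncomputable def multiDeriv {n : ℕ} (u : Fin n → W) (α : Fin n → ℕ) (F : Smooth W) : Smooth W :=
  (List.finRange n).foldr (fun i g => (dirDeriv (u i))^[α i] g) F

lemma dirDeriv_multiDeriv {n : ℕ} (v : W) (u : Fin n → W) (α : Fin n → ℕ) (F : Smooth W) :
    dirDeriv v (multiDeriv u α F) = multiDeriv u α (dirDeriv v F) :=
  (List.foldr_hom (dirDeriv v)
    fun i g => ((dirDeriv_comm v (u i)).iterate_right (α i) g).symm).symm

lemma dirDeriv_multiDeriv_self {n : ℕ} (u : Fin n → W) (α : Fin n → ℕ) (a : Fin n)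
    (F : Smooth W) :
    dirDeriv (u a) (multiDeriv u α F) = multiDeriv u (α + Pi.single a 1) F := by
  have key : ∀ l : List (Fin n), l.Nodup →
      (a ∉ l → l.foldr (fun i g => (dirDeriv (u i))^[(α + Pi.single a 1 : Fin n → ℕ) i] g) F =
        l.foldr (fun i g => (dirDeriv (u i))^[α i] g) F) ∧
      (a ∈ l → dirDeriv (u a) (l.foldr (fun i g => (dirDeriv (u i))^[α i] g) F) =
        l.foldr (fun i g => (dirDeriv (u i))^[(α + Pi.single a 1 : Fin n → ℕ) i] g) F) := by
    intro l
    induction l with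
    | nil => simp
    | cons b t ih =>
      intro hnd
      obtain ⟨hb, ht⟩ := List.nodup_cons.mp hnd
      obtain ⟨ih1, ih2⟩ := ih ht
      refine ⟨fun ha => ?_, fun ha => ?_⟩
      · simp only [List.mem_cons, not_or] at ha
        rw [List.foldr_cons, List.foldr_cons, ih1 ha.2]
        simp [Ne.symm ha.1]
      · rw [List.foldr_cons, List.foldr_cons]
        by_cases hab : a = b
        · subst hab
          rw [ih1 hb, ← Function.iterate_succ_apply' (dirDeriv (u a))]
          simp
        · have hat : a ∈ t := (List.mem_cons.mp ha).resolve_left hab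
          rw [← ih2 hat, ((dirDeriv_comm (u a) (u b)).iterate_right (α b)).eq]
          simp [Ne.symm hab]
  exact (key _ (List.nodup_finRange n)).2 (List.mem_finRange a)

lemma iteratedFDeriv_apply_eq_foldr (F : Smooth W) (k : ℕ) (v : Fin k → W) (z : W) :
    iteratedFDeriv ℝ k F.1 z v = ((List.ofFn v).foldr dirDeriv F).1 z := by
  induction k generalizing z with
  | zero => simp
  | succ k ih =>
    have hd : DifferentiableAt ℝ (iteratedFDeriv ℝ k F.1) z :=
      (F.2.differentiable_iteratedFDeriv (by exact_mod_cast WithTop.coe_lt_top k)) z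
    rw [iteratedFDeriv_succ_apply_left, List.ofFn_succ, List.foldr_cons]
    have h1 : ((List.ofFn fun i : Fin k => v i.succ).foldr dirDeriv F).1 =
        fun y => iteratedFDeriv ℝ k F.1 y (Fin.tail v) := funext fun y => (ih _ y).symm
    change _ = fderiv ℝ ((List.ofFn fun i : Fin k => v i.succ).foldr dirDeriv F).1 z (v 0)
    rw [h1]
    have h2 := (hd.hasFDerivAt.continuousMultilinear_apply_const (Fin.tail v)).fderiv
    rw [h2]
    rfl

lemma ContinuousMultilinearMap.norm_le_sum_basis {ι : Type*} [Fintype ι] (b : ι → W)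
    (c : ι → W → ℝ) (hb : ∀ v, v = ∑ j, c j v • b j) (hc : ∀ j v, |c j v| ≤ ‖v‖) {k : ℕ}
    (M : ContinuousMultilinearMap ℝ (fun _ : Fin k => W) ℂ) :
    ‖M‖ ≤ ∑ r : Fin k → ι, ‖M fun i => b (r i)‖ := by
  classical
  refine M.opNorm_le_bound (Finset.sum_nonneg fun _ _ => norm_nonneg _) fun v => ?_
  have h1 : M v = ∑ r : Fin k → ι, (∏ i, c (r i) (v i)) • M fun i => b (r i) := by
    have : v = fun i => ∑ j, c j (v i) • b j := funext fun i => hb (v i)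
    conv_lhs => rw [this]
    rw [M.map_sum]
    exact Finset.sum_congr rfl fun r _ => M.map_smul_univ _ _
  rw [h1, Finset.sum_mul]
  refine (norm_sum_le _ _).trans (Finset.sum_le_sum fun r _ => ?_)
  rw [norm_smul, mul_comm, Real.norm_eq_abs, Finset.abs_prod]
  gcongr
  exact hc _ _

end SmoothFunctions

section SymbolBounds

variable {n : ℕ}

/-- The coordinate vectors of the phase space `ℝⁿ × ℝⁿ`. -/
noncomputable def phaseBasis : Fin n ⊕ Fin n → En n × En n :=
  Sum.elim (fun i => (EuclideanSpace.single i 1, 0)) (fun i => (0, EuclideanSpace.single i 1))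

lemma mpd_snd (G : Smooth (En n × En n)) (β : Fin n → ℕ) (y : En n) :
    mpd β (fun ξ => G.1 (y, ξ)) =
      fun ξ => (multiDeriv (fun i => phaseBasis (.inr i)) β G).1 (y, ξ) := by
  refine List.foldr_hom (fun (H : Smooth (En n × En n)) (ξ : En n) => H.1 (y, ξ)) fun i H => ?_
  refine (Function.Semiconj.iterate_right
    (f := fun (H : Smooth (En n × En n)) (ξ : En n) => H.1 (y, ξ)) (fun K => ?_) (β i) H).symm
  funext ξ
  have h1 : HasFDerivAt K.1 (fderiv ℝ K.1 (y, ξ)) (y, ξ) :=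
    (K.2.differentiable (by simp) _).hasFDerivAt
  have h2 := (HasFDerivAt.comp ξ h1 (hasFDerivAt_prodMk_right y ξ)).fderiv
  simp only [pd]
  change _ = fderiv ℝ (K.1 ∘ fun ξ => (y, ξ)) ξ _
  rw [h2]
  simp [dirDeriv, phaseBasis]

lemma mpd_fst (G : Smooth (En n × En n)) (α : Fin n → ℕ) (ξ : En n) :
    mpd α (fun y => G.1 (y, ξ)) =
      fun y => (multiDeriv (fun i => phaseBasis (.inl i)) α G).1 (y, ξ) := by
  refine List.foldr_hom (fun (H : Smooth (En n × En n)) (y : En n) => H.1 (y, ξ)) fun i H => ?_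
  refine (Function.Semiconj.iterate_right
    (f := fun (H : Smooth (En n × En n)) (y : En n) => H.1 (y, ξ)) (fun K => ?_) (α i) H).symm
  funext y
  have h1 : HasFDerivAt K.1 (fderiv ℝ K.1 (y, ξ)) (y, ξ) :=
    (K.2.differentiable (by simp) _).hasFDerivAt
  have h0 : HasFDerivAt (fun e : En n => (e, ξ)) (ContinuousLinearMap.inl ℝ (En n) (En n)) y :=
    hasFDerivAt_prodMk_left y ξ
  have h2 := (HasFDerivAt.comp y h1 h0).fderiv
  simp only [pd]
  change _ = fderiv ℝ (K.1 ∘ fun y => (y, ξ)) y _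
  rw [h2]
  simp [dirDeriv, phaseBasis]

lemma mixpd_eq_multiDeriv (G : Smooth (En n × En n)) (α β : Fin n → ℕ) (x ξ : En n) :
    mixpd α β (fun y ζ => G.1 (y, ζ)) x ξ =
      (multiDeriv (fun i => phaseBasis (.inl i)) α
        (multiDeriv (fun i => phaseBasis (.inr i)) β G)).1 (x, ξ) := by
  simp only [mixpd, mpd_snd]
  rw [mpd_fst]

lemma exists_foldr_dirDeriv_eq (G : Smooth (En n × En n)) (l : List (Fin n ⊕ Fin n)) :
    ∃ α β : Fin n → ℕ, (l.map phaseBasis).foldr dirDeriv G =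
        multiDeriv (fun i => phaseBasis (.inl i)) α
          (multiDeriv (fun i => phaseBasis (.inr i)) β G) ∧
      ((∃ j ∈ l, j.isRight) → 1 ≤ ∑ i, β i) := by
  induction l with
  | nil =>
    refine ⟨0, 0, ?_, by simp⟩
    simp [multiDeriv]
  | cons j t ih =>
    obtain ⟨α, β, h1, h2⟩ := ih
    rw [List.map_cons, List.foldr_cons, h1]
    rcases j with i | i
    · refine ⟨α + Pi.single i 1, β,
        dirDeriv_multiDeriv_self (fun i => phaseBasis (.inl i)) α i _, fun ⟨j, hj, hr⟩ => h2 ?_⟩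
      rcases List.mem_cons.mp hj with rfl | hj
      · simp at hr
      · exact ⟨j, hj, hr⟩
    · refine ⟨α, β + Pi.single i 1, ?_, fun _ => ?_⟩
      · rw [dirDeriv_multiDeriv,
          dirDeriv_multiDeriv_self (fun i => phaseBasis (.inr i)) β i]
      · calc 1 ≤ (β + Pi.single i 1 : Fin n → ℕ) i := by simp
          _ ≤ _ := Finset.single_le_sum (f := (β + Pi.single i 1 : Fin n → ℕ)) (fun _ _ => Nat.zero_le _)
            (Finset.mem_univ i)

lemma exists_bound_iteratedFDeriv_basis {Λ : En n → ℝ} {μ₀ μ₁ μ ρ : ℝ}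
    (hw : IsWeight n Λ μ₀ μ₁ μ) (hρ : 0 < ρ) {σ : En n → En n → ℂ} (hσ : SClass Λ ρ 0 σ)
    (k : ℕ) (r : Fin k → Fin n ⊕ Fin n) :
    ∃ C > 0, ∀ x ξ : En n,
      ‖iteratedFDeriv ℝ k (fun q : En n × En n => σ q.1 q.2) (x, ξ)
        (fun i => phaseBasis (r i))‖ ≤
        C * (if ∃ i, (r i).isRight then (1 + ‖ξ‖) ^ (-(ρ * μ₀)) else 1) := by
  obtain ⟨hS, hbound⟩ := hσ
  obtain ⟨α, β, h1, h2⟩ := exists_foldr_dirDeriv_eq ⟨_, hS⟩ (List.ofFn r)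
  obtain ⟨C, hC, hCb⟩ := hbound α β
  obtain ⟨C₀, C₁, hC₀, -, hg⟩ := hw.growth
  set j : ℝ := ∑ i, (β i : ℝ) with hj
  have hj0 : 0 ≤ j := Finset.sum_nonneg fun _ _ => Nat.cast_nonneg _
  refine ⟨C * C₀ ^ (-(ρ * j)), by positivity, fun x ξ => ?_⟩
  have h3 := iteratedFDeriv_apply_eq_foldr ⟨_, hS⟩ k (fun i => phaseBasis (r i)) (x, ξ)
  have h4 : List.ofFn (fun i => phaseBasis (r i)) = (List.ofFn r).map phaseBasis := by
    rw [List.map_ofFn]; rfl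
  rw [h3, h4, h1, ← mixpd_eq_multiDeriv ⟨_, hS⟩ α β x ξ]
  have h5 : Λ ξ ^ (0 - ρ * j) ≤ C₀ ^ (-(ρ * j)) * (1 + ‖ξ‖) ^ (-(ρ * μ₀) * j) := by
    have hpos : 0 < 1 + ‖ξ‖ := by positivity
    calc Λ ξ ^ (0 - ρ * j) ≤ (C₀ * (1 + ‖ξ‖) ^ μ₀) ^ (-(ρ * j)) := by
          rw [zero_sub]
          exact Real.rpow_le_rpow_of_nonpos (by positivity) (hg ξ).1
            (neg_nonpos.mpr (by positivity))
      _ = _ := by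
          rw [Real.mul_rpow hC₀.le (by positivity), ← Real.rpow_mul hpos.le]
          congr 2
          ring
  refine (hCb x ξ).trans ?_
  rw [mul_assoc]
  refine mul_le_mul_of_nonneg_left (h5.trans ?_) hC.le
  refine mul_le_mul_of_nonneg_left ?_ (by positivity)
  have hone : (1 : ℝ) ≤ 1 + ‖ξ‖ := by simp
  have hκ := mul_pos hρ hw.hμ₀
  split_ifs with hr
  · have : (1 : ℝ) ≤ j := by
      have := h2 (by obtain ⟨i, hi⟩ := hr; exact ⟨r i, by simp [List.mem_ofFn], hi⟩)
      rw [hj]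
      exact_mod_cast this
    exact Real.rpow_le_rpow_of_exponent_le hone (by nlinarith)
  · exact Real.rpow_le_one_of_one_le_of_nonpos hone (by nlinarith)

/-- The anisotropic dilation `(x, ξ) ↦ (δ x, L ξ)` of phase space. -/
noncomputable def phaseDilation (n : ℕ) (δ L : ℝ) : (En n × En n) →L[ℝ] (En n × En n) :=
  (δ • ContinuousLinearMap.fst ℝ (En n) (En n)).prod (L • ContinuousLinearMap.snd ℝ (En n) (En n))

@[simp] lemma phaseDilation_apply (δ L : ℝ) (z : En n × En n) :
    phaseDilation n δ L z = (δ • z.1, L • z.2) := rfl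

lemma eq_sum_phaseBasis (v : En n × En n) :
    v = ∑ j : Fin n ⊕ Fin n, (Sum.elim (fun i => v.1 i) (fun i => v.2 i) j) • phaseBasis j := by
  have key : ∀ y : En n, ∑ i, y i • (EuclideanSpace.single i (1 : ℝ) : En n) = y := by
    intro y
    ext j
    simp [Finset.sum_apply, Pi.single_apply]
  rw [Fintype.sum_sum_type]
  refine Prod.ext ?_ ?_
  · simp [phaseBasis, Prod.fst_sum, key]
  · simp [phaseBasis, Prod.snd_sum, key]

lemma exists_bound_iteratedFDeriv_dilation {Λ : En n → ℝ} {μ₀ μ₁ μ ρ : ℝ}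
    (hw : IsWeight n Λ μ₀ μ₁ μ) (hρ : 0 < ρ) {σ : En n → En n → ℂ} (hσ : SClass Λ ρ 0 σ)
    (N : ℕ) :
    ∃ C > 0, ∀ δ L : ℝ, 0 < δ → δ ≤ 1 → 1 ≤ L → ∀ k, 1 ≤ k → k ≤ N → ∀ z : En n × En n,
      ‖iteratedFDeriv ℝ k ((fun q : En n × En n => σ q.1 q.2) ∘ phaseDilation n δ L) z‖ ≤
        C * (δ + L ^ N * (1 + ‖z.2‖) ^ (-(ρ * μ₀))) := by
  classical
  choose c hc0 hc using fun k r => exists_bound_iteratedFDeriv_basis hw hρ hσ k r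
  have hκ := mul_pos hρ hw.hμ₀
  refine ⟨1 + ∑ k ∈ Finset.range (N + 1), ∑ r : Fin k → Fin n ⊕ Fin n, c k r,
    add_pos_of_pos_of_nonneg one_pos (Finset.sum_nonneg fun k _ => Finset.sum_nonneg fun r _ =>
      (hc0 k r).le), fun δ L hδ hδ1 hL k hk1 hkN z => ?_⟩
  set m : ℝ := (1 + ‖z.2‖) ^ (-(ρ * μ₀)) with hm
  have hm0 : 0 < m := by positivity
  have hL0 : 0 < L := one_pos.trans_le hL
  have hmain : ∀ r : Fin k → Fin n ⊕ Fin n,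
      ‖iteratedFDeriv ℝ k ((fun q : En n × En n => σ q.1 q.2) ∘ phaseDilation n δ L) z
        (fun i => phaseBasis (r i))‖ ≤ c k r * (δ + L ^ N * m) := by
    intro r
    rw [ContinuousLinearMap.iteratedFDeriv_comp_right _ hσ.1 _ (by exact_mod_cast le_top),
      ContinuousMultilinearMap.compContinuousLinearMap_apply]
    have h1 : (fun i => phaseDilation n δ L (phaseBasis (r i))) =
        fun i => (Sum.elim (fun _ => δ) (fun _ => L) (r i)) • phaseBasis (r i) := by
      funext i
      rcases r i with a | a <;> simp [phaseBasis]
    rw [h1, ContinuousMultilinearMap.map_smul_univ, norm_smul, Real.norm_eq_abs, Finset.abs_prod,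
      mul_comm]
    have h2 := hc k r (phaseDilation n δ L z).1 (phaseDilation n δ L z).2
    refine (mul_le_mul_of_nonneg_right h2 (by positivity)).trans ?_
    rw [mul_assoc]
    refine mul_le_mul_of_nonneg_left ?_ (hc0 k r).le
    split_ifs with hr
    · have h3 : (1 + ‖(phaseDilation n δ L z).2‖) ^ (-(ρ * μ₀)) ≤ m := by
        refine Real.rpow_le_rpow_of_nonpos (by positivity) ?_ (by linarith)
        rw [phaseDilation_apply, norm_smul, Real.norm_of_nonneg hL0.le]
        nlinarith [norm_nonneg z.2]
      have h4 : ∏ i, |Sum.elim (fun _ => δ) (fun _ => L) (r i)| ≤ L ^ N := by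
        calc ∏ i, |Sum.elim (fun _ => δ) (fun _ => L) (r i)| ≤ ∏ _i : Fin k, L := by
              refine Finset.prod_le_prod (fun _ _ => abs_nonneg _) fun i _ => ?_
              rcases r i with a | a
              · simpa [abs_of_pos hδ] using hδ1.trans hL
              · simp [abs_of_pos hL0]
          _ = L ^ k := by simp
          _ ≤ L ^ N := pow_le_pow_right₀ hL hkN
      calc _ ≤ m * L ^ N := by gcongr
        _ ≤ _ := by linarith
    · have h4 : ∏ i, |Sum.elim (fun _ => δ) (fun _ => L) (r i)| = δ ^ k := by
        rw [Finset.prod_congr rfl (g := fun _ => δ)]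
        · simp
        · intro i _
          have : ¬ (r i).isRight := fun h => hr ⟨i, h⟩
          rcases hri : r i with a | a
          · simp [abs_of_pos hδ]
          · simp [hri] at this
      rw [h4, one_mul]
      have h5 : δ ^ k ≤ δ := pow_le_of_le_one hδ.le hδ1 (by omega)
      have : 0 ≤ L ^ N * m := by positivity
      linarith
  refine (ContinuousMultilinearMap.norm_le_sum_basis phaseBasis
    (fun j v => Sum.elim (fun i => v.1 i) (fun i => v.2 i) j) eq_sum_phaseBasis ?_ _).trans ?_
  · rintro (j | j) v
    · exact (PiLp.norm_apply_le v.1 j).trans (norm_fst_le v)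
    · exact (PiLp.norm_apply_le v.2 j).trans (norm_snd_le v)
  refine (Finset.sum_le_sum fun r _ => hmain r).trans ?_
  rw [← Finset.sum_mul]
  refine mul_le_mul_of_nonneg_right ?_ (by positivity)
  have := Finset.single_le_sum (f := fun k => ∑ r : Fin k → Fin n ⊕ Fin n, c k r)
    (fun k _ => Finset.sum_nonneg fun r _ => (hc0 k r).le)
    (Finset.mem_range.mpr (Nat.lt_succ_of_le hkN))
  linarith

end SymbolBounds

section Scaling

variable {n : ℕ}

/-- The normalising constant of the unitary Fourier transform. -/
noncomputable def ftConst (n : ℕ) : ℝ := (2 * π) ^ (-(n : ℝ) / 2)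

lemma ftConst_pos (n : ℕ) : 0 < ftConst n := by unfold ftConst; positivity

lemma ftConst_sq (n : ℕ) : ftConst n ^ 2 = ((2 * π) ^ n)⁻¹ := by
  have h : (0 : ℝ) ≤ 2 * π := by positivity
  rw [ftConst, ← Real.rpow_natCast, ← Real.rpow_mul h, ← Real.rpow_natCast, ← Real.rpow_neg h]
  congr 1
  push_cast
  ring

/-- The dilation `x ↦ φ (δ x)` of a Schwartz function. -/
noncomputable def dilate (δ : ℝ) (hδ : δ ≠ 0) (φ : SchwartzMap (En n) ℂ) :
    SchwartzMap (En n) ℂ :=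
  SchwartzMap.compCLMOfContinuousLinearEquiv ℂ
    (ContinuousLinearEquiv.smulLeft (Units.mk0 δ hδ)) φ

@[simp] lemma dilate_apply (δ : ℝ) (hδ : δ ≠ 0) (φ : SchwartzMap (En n) ℂ) (x : En n) :
    dilate δ hδ φ x = φ (δ • x) := rfl

lemma fourier_dilate {δ : ℝ} (hδ : 0 < δ) (φ : SchwartzMap (En n) ℂ) (ζ : En n) :
    (FourierTransform.fourier (dilate δ hδ.ne' φ) : SchwartzMap (En n) ℂ) ζ =
      (((δ ^ n)⁻¹ * (ftConst n)⁻¹ : ℝ) : ℂ) * ft φ ((2 * π / δ) • ζ) := by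
  rw [SchwartzMap.fourier_coe, fourier_eq_phase]
  have h1 := Measure.integral_comp_smul volume
    (fun x : En n => Complex.exp (-Complex.I * (⟪x, (2 * π / δ) • ζ⟫ : ℂ)) * φ x) δ
  have h2 : ∀ v : En n, phase (-⟪v, ζ⟫) * dilate δ hδ.ne' φ v =
      Complex.exp (-Complex.I * (⟪δ • v, (2 * π / δ) • ζ⟫ : ℂ)) * φ (δ • v) := by
    intro v
    rw [dilate_apply, phase, inner_smul_left, inner_smul_right]
    congr 2
    have : (δ : ℂ) ≠ 0 := by exact_mod_cast hδ.ne'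
    push_cast
    simp only [conj_trivial]
    field_simp
  simp_rw [h2]
  rw [h1, ft, finrank_euclideanSpace_fin, abs_of_pos (by positivity), Complex.real_smul]
  have h3 : (ftConst n : ℂ) ≠ 0 := by exact_mod_cast (ftConst_pos n).ne'
  rw [← ftConst]
  push_cast
  field_simp

lemma ft_eq_fourier (φ : SchwartzMap (En n) ℂ) (ξ : En n) :
    ft φ ξ = (ftConst n : ℂ) *
      (FourierTransform.fourier (dilate 1 one_ne_zero φ) : SchwartzMap (En n) ℂ)
        ((2 * π)⁻¹ • ξ) := by
  rw [fourier_dilate one_pos, smul_smul]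
  have h3 : (ftConst n : ℂ) ≠ 0 := by exact_mod_cast (ftConst_pos n).ne'
  have h4 : 2 * π / 1 * (2 * π)⁻¹ = 1 := by field_simp
  rw [h4, one_smul]
  push_cast
  field_simp
  simp

lemma integrable_norm_ft_sq (φ : SchwartzMap (En n) ℂ) :
    Integrable fun ξ => ‖ft φ ξ‖ ^ 2 := by
  simp_rw [ft_eq_fourier φ, norm_mul, mul_pow]
  have h := ((FourierTransform.fourier (dilate 1 one_ne_zero φ) :
    SchwartzMap (En n) ℂ).memLp 2 volume).integrable_norm_pow (by norm_num)
  exact (h.comp_smul (R := (2 * π)⁻¹) (by positivity)).const_mul _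

lemma integral_weight_fourier_dilate {δ : ℝ} (hδ : 0 < δ) (φ : SchwartzMap (En n) ℂ)
    (w : En n → ℝ) :
    ∫ ζ, w ζ * ‖(FourierTransform.fourier (dilate δ hδ.ne' φ) : SchwartzMap (En n) ℂ) ζ‖ ^ 2 =
      (δ ^ n)⁻¹ * ∫ ξ, w ((2 * π / δ)⁻¹ • ξ) * ‖ft φ ξ‖ ^ 2 := by
  have hL : 0 < 2 * π / δ := by positivity
  have h1 := Measure.integral_comp_smul volume
    (fun ξ : En n => w ((2 * π / δ)⁻¹ • ξ) * ‖ft φ ξ‖ ^ 2) (2 * π / δ)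
  have h2 : ∀ ζ : En n,
      w ζ * ‖(FourierTransform.fourier (dilate δ hδ.ne' φ) : SchwartzMap (En n) ℂ) ζ‖ ^ 2 =
      ((δ ^ n)⁻¹ * (ftConst n)⁻¹) ^ 2 * (w ((2 * π / δ)⁻¹ • (2 * π / δ) • ζ) *
        ‖ft φ ((2 * π / δ) • ζ)‖ ^ 2) := by
    intro ζ
    rw [fourier_dilate hδ, norm_mul, inv_smul_smul₀ hL.ne', mul_pow, Complex.norm_real,
      Real.norm_eq_abs, sq_abs]
    ring
  simp_rw [h2]
  rw [integral_const_mul, h1, finrank_euclideanSpace_fin, abs_of_pos (by positivity), smul_eq_mul,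
    mul_pow, inv_pow (ftConst n), ftConst_sq, ← mul_assoc]
  congr 1
  rw [div_pow]
  field_simp

lemma integral_dilation_mul_kirkwood {δ : ℝ} (hδ : 0 < δ) {σ : En n → En n → ℂ} {M : ℝ}
    (hσ : Continuous fun q : En n × En n => σ q.1 q.2) (hM : ∀ x ξ, ‖σ x ξ‖ ≤ M)
    (φ : SchwartzMap (En n) ℂ) :
    ∫ z, ((fun q : En n × En n => σ q.1 q.2) ∘ phaseDilation n δ (2 * π / δ)) z *
        kirkwood (dilate δ hδ.ne' φ) z =
      (((δ ^ n)⁻¹ : ℝ) : ℂ) * ∫ x, pdo σ φ x * (starRingEnd ℂ) (φ x) := by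
  have hL : 0 < 2 * π / δ := by positivity
  have h_int : Integrable (fun z => ((fun q : En n × En n => σ q.1 q.2) ∘
      phaseDilation n δ (2 * π / δ)) z * kirkwood (dilate δ hδ.ne' φ) z)
      ((volume : Measure (En n)).prod volume) :=
    (integrable_kirkwood (dilate δ hδ.ne' φ)).bdd_mul
      (hσ.comp (phaseDilation n δ (2 * π / δ)).continuous).aestronglyMeasurable
      (Eventually.of_forall fun z => hM _ _)
  have h0 := integral_prod _ h_int
  rw [Measure.volume_eq_prod, h0]
  have hinner : ∀ x : En n, ∫ ζ : En n, ((fun q : En n × En n => σ q.1 q.2) ∘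
      phaseDilation n δ (2 * π / δ)) (x, ζ) * kirkwood (dilate δ hδ.ne' φ) (x, ζ) =
      pdo σ φ (δ • x) * (starRingEnd ℂ) (φ (δ • x)) := by
    intro x
    have h1 := Measure.integral_comp_smul volume (fun ξ : En n =>
      Complex.exp (Complex.I * (⟪δ • x, ξ⟫ : ℂ)) * σ (δ • x) ξ * ft φ ξ) (2 * π / δ)
    have h2 : ∀ ζ : En n, ((fun q : En n × En n => σ q.1 q.2) ∘
        phaseDilation n δ (2 * π / δ)) (x, ζ) * kirkwood (dilate δ hδ.ne' φ) (x, ζ) =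
        ((((δ ^ n)⁻¹ * (ftConst n)⁻¹ : ℝ) : ℂ) * (starRingEnd ℂ) (φ (δ • x))) *
        (Complex.exp (Complex.I * (⟪δ • x, (2 * π / δ) • ζ⟫ : ℂ)) *
          σ (δ • x) ((2 * π / δ) • ζ) * ft φ ((2 * π / δ) • ζ)) := by
      intro ζ
      have h3 : phase ⟪x, ζ⟫ = Complex.exp (Complex.I * (⟪δ • x, (2 * π / δ) • ζ⟫ : ℂ)) := by
        rw [phase, inner_smul_left, inner_smul_right]
        congr 1
        have : (δ : ℂ) ≠ 0 := by exact_mod_cast hδ.ne'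
        push_cast
        simp only [conj_trivial]
        field_simp
      rw [kirkwood, fourier_dilate hδ, dilate_apply]
      simp only [Function.comp_apply, phaseDilation_apply]
      rw [h3]
      ring
    simp_rw [h2]
    rw [integral_const_mul, h1, pdo, finrank_euclideanSpace_fin, abs_of_pos (by positivity),
      Complex.real_smul, ← ftConst]
    set I := ∫ ξ : En n, Complex.exp (Complex.I * (⟪δ • x, ξ⟫ : ℂ)) * σ (δ • x) ξ * ft φ ξ
    have h4 : (δ ^ n)⁻¹ * (ftConst n)⁻¹ * ((2 * π / δ) ^ n)⁻¹ = ftConst n := by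
      have h5 := ftConst_sq n
      have h6 := (ftConst_pos n).ne'
      rw [div_pow]
      have h7 : (2 * π) ^ n * ftConst n ^ 2 = 1 := by
        rw [h5]; exact mul_inv_cancel₀ (by positivity)
      have h8 : (0 : ℝ) < (2 * π) ^ n := by positivity
      have h9 : (0 : ℝ) < δ ^ n := by positivity
      generalize (2 * π) ^ n = u at *
      generalize δ ^ n = d at *
      field_simp
      linarith
    calc _ = (((δ ^ n)⁻¹ * (ftConst n)⁻¹ * ((2 * π / δ) ^ n)⁻¹ : ℝ) : ℂ) * I *
          (starRingEnd ℂ) (φ (δ • x)) := by push_cast; ring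
      _ = _ := by rw [h4]
  simp_rw [hinner]
  have h1 := Measure.integral_comp_smul volume
    (fun x : En n => pdo σ φ x * (starRingEnd ℂ) (φ x)) δ
  rw [h1, finrank_euclideanSpace_fin, abs_of_pos (by positivity), Complex.real_smul]

end Scaling

section Weights

lemma one_add_norm_rpow_neg_slowly_varying {V : Type*} [NormedAddCommGroup V] {κ : ℝ}
    (hκ : 0 ≤ κ) (hκ1 : κ ≤ 1) (η η' : V) :
    (1 + ‖η‖) ^ (-κ) ≤ (1 + ‖η - η'‖) * (1 + ‖η'‖) ^ (-κ) := by
  have h1 : 1 + ‖η'‖ ≤ (1 + ‖η - η'‖) * (1 + ‖η‖) := by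
    have := norm_le_norm_add_norm_sub' η' η
    rw [norm_sub_rev] at this
    nlinarith [norm_nonneg η, norm_nonneg (η - η'), mul_nonneg (norm_nonneg η)
      (norm_nonneg (η - η'))]
  have h2 : (1 + ‖η'‖) ^ κ ≤ (1 + ‖η - η'‖) * (1 + ‖η‖) ^ κ := by
    calc (1 + ‖η'‖) ^ κ ≤ ((1 + ‖η - η'‖) * (1 + ‖η‖)) ^ κ :=
          Real.rpow_le_rpow (by positivity) h1 hκ
      _ = (1 + ‖η - η'‖) ^ κ * (1 + ‖η‖) ^ κ := Real.mul_rpow (by positivity) (by positivity)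
      _ ≤ _ := by
          gcongr
          exact Real.rpow_le_self_of_one_le (by simp) hκ1
  rw [Real.rpow_neg (by positivity), Real.rpow_neg (by positivity)]
  have h3 : 0 < (1 + ‖η'‖) ^ κ := by positivity
  have h4 : 0 < (1 + ‖η‖) ^ κ := by positivity
  rw [← div_eq_mul_inv, inv_eq_one_div, div_le_div_iff₀ h4 h3]
  linarith

lemma IsWeight.exists_absorb {n : ℕ} {Λ : En n → ℝ} {μ₀ μ₁ μ : ℝ} (hw : IsWeight n Λ μ₀ μ₁ μ)
    {κ ε K L s : ℝ} (hκ : 0 < κ) (hε : 0 < ε) (hK : 0 < K) (hL : 0 < L) (hs : 0 ≤ s) :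
    ∃ Cs > 0, ∀ ξ : En n, K * (1 + ‖L⁻¹ • ξ‖) ^ (-κ) ≤ ε + Cs * Λ ξ ^ (-(2 * s)) := by
  obtain ⟨C₀, C₁, hC₀, hC₁, hg⟩ := hw.growth
  have hC₁0 : 0 < C₁ := hC₀.trans_le hC₁
  have hμ₁ : 0 < μ₁ := hw.hμ₀.trans_le hw.hμ₀₁
  have ht := (tendsto_rpow_neg_atTop hκ).const_mul K
  rw [mul_zero] at ht
  obtain ⟨a, ha⟩ := eventually_atTop.mp (ht.eventually (ge_mem_nhds hε))
  set r : ℝ := L * max a 0 with hr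
  have hr0 : 0 ≤ r := by positivity
  set q : ℝ := (C₁ * (1 + r) ^ μ₁) ^ (-(2 * s)) with hq
  have hq0 : 0 < q := by positivity
  refine ⟨K / q, by positivity, fun ξ => ?_⟩
  have hΛ : 0 < Λ ξ ^ (-(2 * s)) := Real.rpow_pos_of_pos (hw.pos ξ) _
  rw [norm_smul, norm_inv, Real.norm_of_nonneg hL.le]
  by_cases hξ : r ≤ ‖ξ‖
  · have h1 : a ≤ 1 + L⁻¹ * ‖ξ‖ := by
      have h2 : max a 0 ≤ L⁻¹ * ‖ξ‖ := by
        rw [← div_eq_inv_mul, le_div_iff₀ hL]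
        linarith
      have := le_max_left a 0
      linarith
    have h2 : 0 < K / q * Λ ξ ^ (-(2 * s)) := by positivity
    have h3 := ha _ h1
    linarith
  · have h1 : (1 + L⁻¹ * ‖ξ‖) ^ (-κ) ≤ 1 :=
      Real.rpow_le_one_of_one_le_of_nonpos (by simp; positivity) (by linarith)
    have h2 : q ≤ Λ ξ ^ (-(2 * s)) := by
      refine Real.rpow_le_rpow_of_nonpos (hw.pos ξ) ((hg ξ).2.trans ?_) (by linarith)
      gcongr
      exact (not_le.mp hξ).le
    calc K * (1 + L⁻¹ * ‖ξ‖) ^ (-κ) ≤ K * 1 := by gcongr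
      _ = K / q * q := by field_simp
      _ ≤ K / q * Λ ξ ^ (-(2 * s)) := by gcongr
      _ ≤ _ := by linarith

lemma IsWeight.integrable_rpow_mul_norm_ft_sq {n : ℕ} {Λ : En n → ℝ} {μ₀ μ₁ μ : ℝ}
    (hw : IsWeight n Λ μ₀ μ₁ μ) {s : ℝ} (hs : 0 ≤ s) (φ : SchwartzMap (En n) ℂ) :
    Integrable fun ξ => Λ ξ ^ (-(2 * s)) * ‖ft φ ξ‖ ^ 2 := by
  obtain ⟨C₀, C₁, hC₀, -, hg⟩ := hw.growth
  refine (integrable_norm_ft_sq φ).bdd_mul (c := C₀ ^ (-(2 * s)))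
    (hw.smooth.continuous.rpow_const fun ξ => Or.inl (hw.pos ξ).ne').aestronglyMeasurable
    (Eventually.of_forall fun ξ => ?_)
  rw [Real.norm_of_nonneg (Real.rpow_nonneg (hw.pos ξ).le _)]
  refine Real.rpow_le_rpow_of_nonpos hC₀ (le_trans ?_ (hg ξ).1) (by linarith)
  exact le_mul_of_one_le_right hC₀.le (Real.one_le_rpow (by simp) hw.hμ₀.le)

lemma MClass.sClass {n : ℕ} {Λ : En n → ℝ} {ρ m : ℝ} {σ : En n → En n → ℂ}
    (hσ : MClass Λ ρ m σ) : SClass Λ ρ m σ := by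
  have h : mixpd 0 0 σ = σ := by
    funext x ξ
    simp [mixpd, mpd]
  simpa [h] using hσ 0 (by simp)

lemma SClass.exists_bound {n : ℕ} {Λ : En n → ℝ} {ρ : ℝ} {σ : En n → En n → ℂ}
    (hσ : SClass Λ ρ 0 σ) : ∃ M > 0, ∀ x ξ, ‖σ x ξ‖ ≤ M := by
  obtain ⟨M, hM, h⟩ := hσ.2 0 0
  refine ⟨M, hM, fun x ξ => ?_⟩
  simpa [mixpd, mpd] using h x ξ

end Weights

/-- Gårding's inequality for strongly M-elliptic symbols of order `0`. -/
theorem garding_order_zero (n : ℕ) (hn : 1 ≤ n)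
    (Λ : En n → ℝ) (μ₀ μ₁ μ ρ : ℝ)
    (hw : IsWeight n Λ μ₀ μ₁ μ) (hρ : 0 < ρ) (hρμ : ρ ≤ 1 / μ)
    (σ : En n → En n → ℂ) (hσ : MClass Λ ρ 0 σ)
    (C R : ℝ) (hC : 0 < C) (hR : 0 < R)
    (hell : ∀ x ξ : En n, R ≤ ‖ξ‖ → C ≤ (σ x ξ).re) :
    ∃ C' > 0, ∀ s : ℝ, ρ / 2 ≤ s → ∃ Cs > 0, ∀ φ : SchwartzMap (En n) ℂ,
      C' * (∫ (ξ : En n), ‖ft (⇑φ) ξ‖ ^ 2) -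
          Cs * ∫ (ξ : En n), Λ ξ ^ (-(2 * s)) * ‖ft (⇑φ) ξ‖ ^ 2 ≤
        (∫ (x : En n), pdo σ (⇑φ) x * (starRingEnd ℂ) (φ x)).re := by
  have hS := hσ.sClass
  obtain ⟨M, hM0, hM⟩ := hS.exists_bound
  set N := Module.finrank ℝ (En n × En n) + 2 with hN
  obtain ⟨A, hA, hcore⟩ := garding_of_slowly_varying_weight (E := En n) N (by omega)
  obtain ⟨K, hK, hder⟩ := exists_bound_iteratedFDeriv_dilation hw hρ hS N
  set κ := ρ * μ₀ with hκdef
  have hκ : 0 < κ := mul_pos hρ hw.hμ₀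
  have hκ1 : κ ≤ 1 := by
    have hμ : 0 < μ := hw.hμ₀.trans_le (hw.hμ₀₁.trans hw.hμ₁)
    calc κ ≤ 1 / μ * μ := mul_le_mul hρμ (hw.hμ₀₁.trans hw.hμ₁) hw.hμ₀.le (one_div_pos.mpr hμ).le
      _ = 1 := by field_simp
  set δ := min 1 (C / (4 * A * K)) with hδdef
  have hδ : 0 < δ := by positivity
  have hδ1 : δ ≤ 1 := min_le_left _ _
  have hδA : A * (K * δ) ≤ C / 4 := by
    have h1 : δ ≤ C / (4 * A * K) := min_le_right _ _
    rw [le_div_iff₀ (by positivity)] at h1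
    linarith
  set L := 2 * π / δ with hLdef
  have hL : 1 ≤ L := by
    rw [hLdef, le_div_iff₀ hδ]
    linarith [Real.pi_gt_three]
  have hL0 : 0 < L := one_pos.trans_le hL
  set B := K * L ^ N + (M + C) * (1 + R) ^ κ with hB
  have hB0 : 0 < B := by positivity
  refine ⟨C / 2, by positivity, fun s hs => ?_⟩
  have hs0 : 0 ≤ s := by linarith
  obtain ⟨Cs, hCs, habs⟩ := hw.exists_absorb (κ := κ) (ε := C / 4) (K := A * B) (L := L) (s := s)
    hκ (by positivity) (by positivity) hL0 hs0
  refine ⟨Cs, hCs, fun φ => ?_⟩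
  set w : En n → ℝ := fun η => K * δ + B * (1 + ‖η‖) ^ (-κ) with hwdef
  have hw0 : ∀ η, 0 ≤ w η := fun η => by positivity
  have hle1 : ∀ η : En n, (1 + ‖η‖) ^ (-κ) ≤ 1 := fun η =>
    Real.rpow_le_one_of_one_le_of_nonpos (by simp) (by linarith)
  have hwD : ∀ η, w η ≤ K * δ + B := fun η => by
    have := mul_le_mul_of_nonneg_left (hle1 η) hB0.le
    simp only [hwdef]
    linarith
  have hwc : Continuous w := by
    have hc : Continuous fun η : En n => 1 + ‖η‖ := by fun_prop
    exact continuous_const.add (continuous_const.mul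
      (hc.rpow_const fun η => Or.inl (by positivity)))
  have hws : ∀ η η', w η ≤ (1 + ‖η - η'‖) * w η' := by
    intro η η'
    have h1 := mul_le_mul_of_nonneg_left
      (one_add_norm_rpow_neg_slowly_varying hκ.le hκ1 η η') hB0.le
    have h2 : 0 ≤ ‖η - η'‖ * (K * δ) := by positivity
    simp only [hwdef]
    linarith
  have hwder : ∀ k, 1 ≤ k → k ≤ N → ∀ z : En n × En n,
      ‖iteratedFDeriv ℝ k ((fun q : En n × En n => σ q.1 q.2) ∘ phaseDilation n δ L) z‖ ≤
        w z.2 := by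
    intro k hk1 hkN z
    refine (hder δ L hδ hδ1 hL k hk1 hkN z).trans ?_
    have : 0 ≤ (M + C) * (1 + R) ^ κ * (1 + ‖z.2‖) ^ (-κ) := by positivity
    simp only [hwdef, hB]
    linarith
  have hwell : ∀ z : En n × En n, C - w z.2 ≤
      (((fun q : En n × En n => σ q.1 q.2) ∘ phaseDilation n δ L) z).re := by
    intro z
    by_cases hz : R ≤ ‖L • z.2‖
    · exact (sub_le_self _ (hw0 _)).trans (hell _ _ hz)
    · have h1 : ‖z.2‖ ≤ R := by
        rw [norm_smul, Real.norm_of_nonneg hL0.le] at hz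
        nlinarith [norm_nonneg z.2]
      have h2 : 1 ≤ (1 + R) ^ κ * (1 + ‖z.2‖) ^ (-κ) := by
        rw [Real.rpow_neg (by positivity), ← div_eq_mul_inv, one_le_div (by positivity)]
        gcongr
      have h3 : -M ≤ (σ (δ • z.1) (L • z.2)).re :=
        (abs_le.mp ((Complex.abs_re_le_norm _).trans (hM _ _))).1
      have h4 : M + C ≤ w z.2 := by
        have h5 := mul_le_mul_of_nonneg_left h2 (add_pos hM0 hC).le
        have h6 : 0 ≤ K * δ + K * L ^ N * (1 + ‖z.2‖) ^ (-κ) := by positivity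
        simp only [hwdef, hB]
        linarith
      simp only [Function.comp_apply, phaseDilation_apply]
      linarith
  have hmain := hcore ((fun q : En n × En n => σ q.1 q.2) ∘ phaseDilation n δ L) w M (K * δ + B) C
    (hS.1.comp (phaseDilation n δ L).contDiff) (fun z => hM _ _) hwc hw0 hwD hws hwder hwell
    (dilate δ hδ.ne' φ)
  rw [integral_dilation_mul_kirkwood hδ hS.1.continuous hM, integral_weight_fourier_dilate hδ,
    Complex.re_ofReal_mul] at hmain
  have hone := integral_weight_fourier_dilate hδ φ fun _ => 1
  simp only [one_mul] at hone
  rw [hone] at hmain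
  have hdn : 0 < (δ ^ n)⁻¹ := by positivity
  have hmain' : C * (∫ ξ, ‖ft φ ξ‖ ^ 2) - A * (∫ ξ, w (L⁻¹ • ξ) * ‖ft φ ξ‖ ^ 2) ≤
      (∫ x, pdo σ φ x * (starRingEnd ℂ) (φ x)).re := by
    refine le_of_mul_le_mul_left (le_trans (le_of_eq ?_) hmain) hdn
    ring
  refine le_trans ?_ hmain'
  have hf := integrable_norm_ft_sq φ
  have hg := hw.integrable_rpow_mul_norm_ft_sq hs0 φ
  have hwf : Integrable fun ξ => w (L⁻¹ • ξ) * ‖ft φ ξ‖ ^ 2 :=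
    hf.bdd_mul (c := K * δ + B) (hwc.comp (continuous_const_smul _)).aestronglyMeasurable
      (Eventually.of_forall fun ξ => by
        rw [Real.norm_of_nonneg (hw0 _)]
        exact hwD _)
  have hkey : A * (∫ ξ, w (L⁻¹ • ξ) * ‖ft φ ξ‖ ^ 2) ≤
      C / 2 * (∫ ξ, ‖ft φ ξ‖ ^ 2) + Cs * ∫ ξ, Λ ξ ^ (-(2 * s)) * ‖ft φ ξ‖ ^ 2 := by
    rw [← integral_const_mul, ← integral_const_mul, ← integral_const_mul,
      ← integral_add (hf.const_mul _) (hg.const_mul _)]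
    refine integral_mono (hwf.const_mul _) ((hf.const_mul _).add (hg.const_mul _)) fun ξ => ?_
    have h1 : A * w (L⁻¹ • ξ) ≤ C / 2 + Cs * Λ ξ ^ (-(2 * s)) := by
      have := habs ξ
      simp only [hwdef]
      linarith
    have h2 := mul_le_mul_of_nonneg_right h1 (sq_nonneg ‖ft φ ξ‖)
    linarith
  linarith
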